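/- arXiv:1509.07138 — 14 statements merged into one kernel-verified Lean document; each statement's English description precedes it below -/
import Mathlib

section
/- Let n, m be integers with 0 < m < n. Let (n11, n10, n01, n00) be an observed table, i.e., nonnegative integers with n11 + n10 = m and n11 + n10 + n01 + n00 = n, and let N = (N11, N10, N01, N00) be a potential table, i.e., nonnegative integers with N11 + N10 + N01 + N00 = n. Then N is compatible with the observed table if and only if max{0, n11 − N10, N11 − n01, N11 + N01 − n10 − n01} ≤ min{N11, n11, N11 + N01 − n01, n − N10 − n01 − n10}. -/
open Finset

/-- Number of treated units with outcome 1: `n11(S) = #{j ∈ S : y1 j = 1}`. -/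
def nObs11 {n : ℕ} (y1 : Fin n → Bool) (S : Finset (Fin n)) : ℕ :=
  (S.filter (fun j => y1 j = true)).card

/-- Number of treated units with outcome 0: `n10(S) = #{j ∈ S : y1 j = 0}`. -/
def nObs10 {n : ℕ} (y1 : Fin n → Bool) (S : Finset (Fin n)) : ℕ :=
  (S.filter (fun j => y1 j = false)).card

/-- Number of control units with outcome 1: `n01(S) = #{j ∉ S : y0 j = 1}`. -/
def nObs01 {n : ℕ} (y0 : Fin n → Bool) (S : Finset (Fin n)) : ℕ :=
  (Sᶜ.filter (fun j => y0 j = true)).card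

/-- Number of control units with outcome 0: `n00(S) = #{j ∉ S : y0 j = 0}`. -/
def nObs00 {n : ℕ} (y0 : Fin n → Bool) (S : Finset (Fin n)) : ℕ :=
  (Sᶜ.filter (fun j => y0 j = false)).card

/-- The potential table `(N11, N10, N01, N00)` of potential outcomes `(y1, y0)`. -/
def potTable {n : ℕ} (y1 y0 : Fin n → Bool) : ℕ × ℕ × ℕ × ℕ :=
  ((univ.filter (fun j => y1 j = true ∧ y0 j = true)).card,
   (univ.filter (fun j => y1 j = true ∧ y0 j = false)).card,
   (univ.filter (fun j => y1 j = false ∧ y0 j = true)).card,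
   (univ.filter (fun j => y1 j = false ∧ y0 j = false)).card)

/-- The observed table `(n11(S), n10(S), n01(S), n00(S))`. -/
def obsTable {n : ℕ} (y1 y0 : Fin n → Bool) (S : Finset (Fin n)) : ℕ × ℕ × ℕ × ℕ :=
  (nObs11 y1 S, nObs10 y1 S, nObs01 y0 S, nObs00 y0 S)

/-- The estimator `τ̂(S) = n11(S)/m - n01(S)/(n - m)`. -/
def tauHat {n : ℕ} (m : ℕ) (y1 y0 : Fin n → Bool) (S : Finset (Fin n)) : ℚ :=
  (nObs11 y1 S : ℚ) / m - (nObs01 y0 S : ℚ) / ((n : ℚ) - m)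

/-- The average causal effect `τ = (N10 - N01)/n` of potential outcomes `(y1, y0)`. -/
def tauPO {n : ℕ} (y1 y0 : Fin n → Bool) : ℚ :=
  (((potTable y1 y0).2.1 : ℚ) - ((potTable y1 y0).2.2.1 : ℚ)) / n

/-- One-sided p-value at threshold `t`:
`#{S : |S| = m, τ̂(S) ≥ t} / C(n, m)`. -/
def pOne {n : ℕ} (m : ℕ) (t : ℚ) (y1 y0 : Fin n → Bool) : ℚ :=
  ((((univ : Finset (Fin n)).powersetCard m).filter
      (fun S => t ≤ tauHat m y1 y0 S)).card : ℚ) / (n.choose m)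

/-- Two-sided p-value at threshold `t`:
`#{S : |S| = m, |τ̂(S) - τ| ≥ |t - τ|} / C(n, m)` where `τ` is the average causal
effect of `(y1, y0)`. -/
def pTwo {n : ℕ} (m : ℕ) (t : ℚ) (y1 y0 : Fin n → Bool) : ℚ :=
  ((((univ : Finset (Fin n)).powersetCard m).filter
      (fun S => |t - tauPO y1 y0| ≤ |tauHat m y1 y0 S - tauPO y1 y0|)).card : ℚ) / (n.choose m)

/-- Canonical treatment potential outcomes realizing a table: first `N11 + N10` units
have `y1 = 1`. -/
def canY1 (n N11 N10 : ℕ) : Fin n → Bool :=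
  fun j => decide (j.val < N11 + N10)

/-- Canonical control potential outcomes realizing a table: first `N11` units and the
`N01` units following the first `N11 + N10` ones have `y0 = 1`. -/
def canY0 (n N11 N10 N01 : ℕ) : Fin n → Bool :=
  fun j => decide (j.val < N11 ∨ (N11 + N10 ≤ j.val ∧ j.val < N11 + N10 + N01))

/-- One-sided p-value of a potential table `N = (N11, N10, N01, N00)`, well defined
since the p-value depends on the potential outcomes only through the table. -/
def pOneTable (n m : ℕ) (t : ℚ) (N11 N10 N01 N00 : ℕ) : ℚ :=
  pOne m t (canY1 n N11 N10) (canY0 n N11 N10 N01)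

/-- Two-sided p-value of a potential table `N = (N11, N10, N01, N00)`:
`#{S : |S| = m, |τ̂(S) - τ(N)| ≥ |t - τ(N)|} / C(n, m)` with `τ(N) = (N10 - N01)/n`,
well defined since it depends on the potential outcomes only through the table. -/
def pTwoTable (n m : ℕ) (t : ℚ) (N11 N10 N01 N00 : ℕ) : ℚ :=
  ((((univ : Finset (Fin n)).powersetCard m).filter
      (fun S => |t - ((N10 : ℚ) - N01) / n| ≤
        |tauHat m (canY1 n N11 N10) (canY0 n N11 N10 N01) S - ((N10 : ℚ) - N01) / n|)).card : ℚ)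
    / (n.choose m)

/-- A potential table `N` is compatible with an observed table `obs` if some potential
outcomes with table `N` produce `obs` under some assignment of `m` units to treatment. -/
def Compatible (n m : ℕ) (N obs : ℕ × ℕ × ℕ × ℕ) : Prop :=
  ∃ (y1 y0 : Fin n → Bool) (S : Finset (Fin n)),
    S.card = m ∧ potTable y1 y0 = N ∧ obsTable y1 y0 S = obs


/-- Counting through a classifying map: the number of `i` whose class satisfies `p` is the sum of
the sizes of the classes satisfying `p`. -/
theorem card_filter_comp_eq_sum_card_fiber {ι α : Type*} [Fintype ι] [Fintype α] [DecidableEq α]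
    (f : ι → α) (p : α → Prop) [DecidablePred p] :
    (univ.filter (fun i => p (f i))).card =
      ∑ a, if p a then (univ.filter (fun i => f i = a)).card else 0 := by
  rw [← Finset.sum_filter, Finset.card_eq_sum_card_fiberwise (f := f) (t := univ.filter p)
    (fun i hi => by simpa using hi)]
  refine Finset.sum_congr rfl fun a ha => ?_
  congr 1
  ext i
  simp only [mem_filter, mem_univ, true_and] at ha ⊢
  exact ⟨fun h => h.2, fun h => ⟨h ▸ ha, h⟩⟩

/-- Class sizes summing to `n` are realized by some classification of `Fin n`. -/
theorem exists_card_fiber_eq {α : Type*} [Fintype α] [DecidableEq α] {n : ℕ} (c : α → ℕ)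
    (hc : ∑ a, c a = n) :
    ∃ f : Fin n → α, ∀ a, (univ.filter (fun i => f i = a)).card = c a := by
  have e : Fin n ≃ Σ a, Fin (c a) := Fintype.equivOfCardEq (by simp [hc])
  refine ⟨fun i => (e i).1, fun a => ?_⟩
  rw [← Fintype.card_subtype, ← Fintype.card_fin (c a)]
  exact Fintype.card_congr
    ((e.subtypeEquiv (p := fun i => (e i).1 = a) (q := fun x => x.1 = a) fun _ => Iff.rfl).trans
      (Equiv.sigmaSubtype a))

/-- The potential table, the observed table and the assignment size all depend only on the sizes
of the cells of the classification of units by `(y1, y0, treated)`. -/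
theorem tables_eq_sum_card_cell {n : ℕ} (f : Fin n → Bool × Bool × Bool) (S : Finset (Fin n))
    (hS : ∀ j, j ∈ S ↔ (f j).2.2 = true) (c : Bool × Bool × Bool → ℕ)
    (hc : ∀ a, (univ.filter (fun j => f j = a)).card = c a) :
    S.card = c (true, true, true) + c (true, false, true) + c (false, true, true)
      + c (false, false, true) ∧
    potTable (fun j => (f j).1) (fun j => (f j).2.1) =
      (c (true, true, true) + c (true, true, false),
       c (true, false, true) + c (true, false, false),
       c (false, true, true) + c (false, true, false),
       c (false, false, true) + c (false, false, false)) ∧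
    obsTable (fun j => (f j).1) (fun j => (f j).2.1) S =
      (c (true, true, true) + c (true, false, true),
       c (false, true, true) + c (false, false, true),
       c (true, true, false) + c (false, true, false),
       c (true, false, false) + c (false, false, false)) := by
  have hcard (p : Bool × Bool × Bool → Prop) [DecidablePred p] :
      (univ.filter (fun j => p (f j))).card = ∑ a, if p a then c a else 0 := by
    simp only [card_filter_comp_eq_sum_card_fiber, hc]
  obtain rfl : S = univ.filter (fun j => (f j).2.2 = true) := by
    ext j
    simp [hS]
  simp only [potTable, obsTable, nObs11, nObs10, nObs01, nObs00, Finset.compl_filter,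
    Finset.filter_filter, Prod.mk.injEq]
  refine ⟨?_, ⟨?_, ?_, ?_, ?_⟩, ?_, ?_, ?_, ?_⟩
  · rw [hcard fun a => a.2.2 = true]
    simp [Fintype.sum_prod_type]; ring
  · rw [hcard fun a => a.1 = true ∧ a.2.1 = true]
    simp [Fintype.sum_prod_type]
  · rw [hcard fun a => a.1 = true ∧ a.2.1 = false]
    simp [Fintype.sum_prod_type]
  · rw [hcard fun a => a.1 = false ∧ a.2.1 = true]
    simp [Fintype.sum_prod_type]
  · rw [hcard fun a => a.1 = false ∧ a.2.1 = false]
    simp [Fintype.sum_prod_type]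
  · rw [hcard fun a => a.2.2 = true ∧ a.1 = true]
    simp [Fintype.sum_prod_type]
  · rw [hcard fun a => a.2.2 = true ∧ a.1 = false]
    simp [Fintype.sum_prod_type]
  · rw [hcard fun a => ¬ a.2.2 = true ∧ a.2.1 = true]
    simp [Fintype.sum_prod_type]
  · rw [hcard fun a => ¬ a.2.2 = true ∧ a.2.1 = false]
    simp [Fintype.sum_prod_type]

/-- Theorem 1: a potential table is compatible with the observed
table iff the max-min inequality holds. -/
theorem compatible_iff (n m : ℕ) (hm : 0 < m) (hmn : m < n)
    (n11 n10 n01 n00 : ℕ) (hobs1 : n11 + n10 = m) (hobs2 : n11 + n10 + n01 + n00 = n)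
    (N11 N10 N01 N00 : ℕ) (hN : N11 + N10 + N01 + N00 = n) :
    Compatible n m (N11, N10, N01, N00) (n11, n10, n01, n00) ↔
      max (max (0 : ℤ) ((n11 : ℤ) - N10)) (max ((N11 : ℤ) - n01) ((N11 : ℤ) + N01 - n10 - n01)) ≤
      min (min (N11 : ℤ) (n11 : ℤ)) (min ((N11 : ℤ) + N01 - n01) ((n : ℤ) - N10 - n01 - n10)) := by
  constructor
  · rintro ⟨y1, y0, S, hS, hpot, hobs⟩
    obtain ⟨-, hpot', hobs'⟩ := tables_eq_sum_card_cell
      (fun j => (y1 j, y0 j, decide (j ∈ S))) S (by simp) _ fun _ => rfl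
    have hp := hpot.symm.trans hpot'
    have ho := hobs.symm.trans hobs'
    simp only [Prod.mk.injEq] at hp ho
    omega
  · intro h
    -- `x` treated units with both potential outcomes 1 determine all the other cells.
    obtain ⟨x, hlower, hupper⟩ : ∃ x : ℕ,
        max (max (0 : ℤ) (n11 - N10)) (max (N11 - n01) (N11 + N01 - n10 - n01)) ≤ x ∧
        x ≤ min (min (N11 : ℤ) n11) (min (N11 + N01 - n01) (n - N10 - n01 - n10)) :=
      ⟨_, Int.self_le_toNat _, by rwa [Int.toNat_of_nonneg (by simp)]⟩
    simp only [max_le_iff, le_min_iff] at hlower hupper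
    clear h
    let c : Bool × Bool × Bool → ℕ
      | (true, true, true) => x
      | (true, true, false) => N11 - x
      | (true, false, true) => n11 - x
      | (true, false, false) => N10 - (n11 - x)
      | (false, true, true) => N11 + N01 - n01 - x
      | (false, true, false) => N01 - (N11 + N01 - n01 - x)
      | (false, false, true) => n10 - (N11 + N01 - n01 - x)
      | (false, false, false) => N00 - (n10 - (N11 + N01 - n01 - x))
    obtain ⟨f, hf⟩ := exists_card_fiber_eq (n := n) c (by
      simp only [Fintype.sum_prod_type, Fintype.sum_bool, c]
      omega)
    obtain ⟨hS, hpot, hobs⟩ := tables_eq_sum_card_cell f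
      (univ.filter fun j => (f j).2.2 = true) (by simp) c hf
    refine ⟨fun j => (f j).1, fun j => (f j).2.1, _, hS.trans ?_, hpot.trans ?_, hobs.trans ?_⟩
    all_goals
      simp only [c, Prod.mk.injEq]
      omega
end

section
/- Let n, m be integers with 0 < m < n and let (n11, n10, n01, n00) be an observed table with n11 + n10 = m and total sum n. If a potential table N = (N11, N10, N01, N00) is compatible with the observed table, then −(n10 + n01) ≤ N10 − N01 ≤ n11 + n00. -/
open Finset

/-- Each unit counted in `{j | y1 j = a ∧ y0 j = b}` is observed either as a treated unit
with outcome `a` or as a control unit with outcome `b`. -/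
theorem card_filter_and_le_observed {n : ℕ} (y1 y0 : Fin n → Bool) (S : Finset (Fin n))
    (a b : Bool) :
    (univ.filter (fun j => y1 j = a ∧ y0 j = b)).card ≤
      (S.filter (fun j => y1 j = a)).card + (Sᶜ.filter (fun j => y0 j = b)).card := by
  refine (card_le_card fun j hj => ?_).trans (card_union_le _ _)
  simp only [mem_union, mem_filter, mem_univ, true_and, mem_compl] at hj ⊢
  tauto

/-- any potential table compatible with the observed table has
`-(n10 + n01) ≤ N10 - N01 ≤ n11 + n00`. -/
theorem tau_range_of_compatible (n m : ℕ) (hm : 0 < m) (hmn : m < n)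
    (n11 n10 n01 n00 : ℕ) (hobs1 : n11 + n10 = m) (hobs2 : n11 + n10 + n01 + n00 = n)
    (N11 N10 N01 N00 : ℕ)
    (hcomp : Compatible n m (N11, N10, N01, N00) (n11, n10, n01, n00)) :
    -((n10 : ℤ) + n01) ≤ (N10 : ℤ) - N01 ∧ (N10 : ℤ) - N01 ≤ (n11 : ℤ) + n00 := by
  obtain ⟨y1, y0, S, -, hN, hobs⟩ := hcomp
  simp only [potTable, obsTable, nObs11, nObs10, nObs01, nObs00, Prod.mk.injEq] at hN hobs
  have h10 := card_filter_and_le_observed y1 y0 S true false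
  have h01 := card_filter_and_le_observed y1 y0 S false true
  omega
end

section
/- For any potential outcomes (y1, y0) on n units with potential table N = (N11, N10, N01, N00) and any 0 < m < n, the average of the estimator τ̂(S) over all subsets S ⊆ Fin n with |S| = m equals the average causal effect: (1 / C(n, m)) · Σ_{S ⊆ Fin n, |S| = m} τ̂(S) = (N10 − N01)/n, as rational numbers. -/
open Finset

/-- Double counting the pairs `(j, S)` with `p j`, `j ∈ S` and `S` an `m`-subset of a finite type. -/
theorem card_mul_sum_powersetCard_card_filter {α : Type*} [Fintype α] [DecidableEq α] {m : ℕ}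
    (hm : 0 < m) (p : α → Prop) [DecidablePred p] :
    Fintype.card α * ∑ S ∈ (univ : Finset α).powersetCard m, (S.filter p).card
      = m * (Fintype.card α).choose m * (univ.filter p).card := by
  have key (j : α) :
      Fintype.card α * (((univ : Finset α).powersetCard m).filter (fun S => j ∈ S)).card
        = m * (Fintype.card α).choose m := by
    have h := card_filter_powersetCard_subset {j} (univ : Finset α) m (subset_univ _)
      (by rwa [card_singleton])
    simp only [singleton_subset_iff, card_singleton, card_univ] at h
    obtain ⟨k, rfl⟩ := Nat.exists_eq_add_of_lt hm
    obtain ⟨N, hN⟩ := Nat.exists_eq_succ_of_ne_zero (Fintype.card_pos_iff.mpr ⟨j⟩).ne'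
    rw [h, hN]
    simpa [mul_comm] using Nat.add_one_mul_choose_eq N k
  have swap : ∑ S ∈ (univ : Finset α).powersetCard m, (S.filter p).card
      = ∑ j ∈ univ.filter p, (((univ : Finset α).powersetCard m).filter (fun S => j ∈ S)).card := by
    convert sum_card_bipartiteAbove_eq_sum_card_bipartiteBelow
      (fun (S : Finset α) j => j ∈ S) using 3 with S
    · ext j
      simp [bipartiteAbove, and_comm]
    · rfl
  rw [swap, mul_sum, sum_congr rfl fun j _ => key j, sum_const, smul_eq_mul, mul_comm]

/-- The units with `y1 = y0 = 1` contribute equally to both marginal counts and cancel. -/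
theorem potTable_sub_eq {n : ℕ} (y1 y0 : Fin n → Bool) :
    ((potTable y1 y0).2.1 : ℚ) - (potTable y1 y0).2.2.1
      = (univ.filter (fun j => y1 j = true)).card - (univ.filter (fun j => y0 j = true)).card := by
  simp only [potTable, card_filter, Nat.cast_sum, ← sum_sub_distrib]
  refine sum_congr rfl fun j _ => ?_
  cases y1 j <;> cases y0 j <;> simp

theorem nObs01_eq_sub {n : ℕ} (y0 : Fin n → Bool) (S : Finset (Fin n)) :
    (nObs01 y0 S : ℚ)
      = (univ.filter (fun j => y0 j = true)).card - (S.filter (fun j => y0 j = true)).card := by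
  rw [eq_sub_iff_add_eq', nObs01]
  norm_cast
  simp only [card_filter, sum_add_sum_compl]

/-- the estimator `τ̂` is unbiased for the average causal effect:
its average over all size-`m` treatment assignments equals `(N10 - N01)/n`. -/
theorem tauHat_unbiased (n m : ℕ) (hm : 0 < m) (hmn : m < n)
    (y1 y0 : Fin n → Bool) (N11 N10 N01 N00 : ℕ)
    (hN : potTable y1 y0 = (N11, N10, N01, N00)) :
    (1 / (n.choose m : ℚ)) *
        ∑ S ∈ (univ : Finset (Fin n)).powersetCard m, tauHat m y1 y0 S
      = ((N10 : ℚ) - N01) / n := by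
  have hn : (n : ℚ) ≠ 0 := by exact_mod_cast (hm.trans hmn).ne'
  have hm' : (m : ℚ) ≠ 0 := by exact_mod_cast hm.ne'
  have hnm : (n : ℚ) - m ≠ 0 := sub_ne_zero.mpr (by exact_mod_cast hmn.ne')
  have hC : (n.choose m : ℚ) ≠ 0 := by exact_mod_cast (Nat.choose_pos hmn.le).ne'
  have hsum (y : Fin n → Bool) :
      ∑ S ∈ (univ : Finset (Fin n)).powersetCard m, ((S.filter (fun j => y j = true)).card : ℚ)
        = m * n.choose m * (univ.filter (fun j => y j = true)).card / n := by
    rw [eq_div_iff hn, mul_comm]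
    have h := card_mul_sum_powersetCard_card_filter hm (fun j => y j = true)
    rw [Fintype.card_fin] at h
    exact_mod_cast h
  have hτ := potTable_sub_eq y1 y0
  rw [hN] at hτ
  rw [hτ]
  simp only [tauHat, nObs01_eq_sub, nObs11, sum_sub_distrib, ← sum_div, hsum, sum_const,
    card_powersetCard, card_univ, Fintype.card_fin, nsmul_eq_mul]
  field_simp
end

section
/- Let (y1, y0) and (y1', y0') be two pairs of potential outcomes on n units that have the same potential table N = (N11, N10, N01, N00), and let 0 < m < n. Then for every rational number t, #{S ⊆ Fin n : |S| = m, τ̂_{(y1,y0)}(S) ≥ t} = #{S ⊆ Fin n : |S| = m, τ̂_{(y1',y0')}(S) ≥ t}. In particular, the one-sided p-value p1 and the two-sided p-value p2 depend on (y1, y0) only through the potential table N. -/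
open Finset

/-- Functions on a finite type whose fibers have equal sizes differ by a permutation. -/
theorem exists_perm_apply_eq_of_card_fiber_eq {α γ : Type*} [Fintype α] [DecidableEq γ]
    {f g : α → γ} (h : ∀ c, (univ.filter (fun a => f a = c)).card =
      (univ.filter (fun a => g a = c)).card) :
    ∃ e : Equiv.Perm α, ∀ a, g (e a) = f a := by
  have fiberEquiv : ∀ c, Nonempty ({a // f a = c} ≃ {a // g a = c}) := fun c =>
    Fintype.card_eq.mp (by simpa only [Fintype.card_subtype] using h c)
  exact ⟨Equiv.ofFiberEquiv fun c => (fiberEquiv c).some, Equiv.ofFiberEquiv_map _⟩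

/-- Potential outcomes with the same potential table agree up to relabelling the units. -/
theorem exists_perm_of_potTable_eq {n : ℕ} {y1 y0 y1' y0' : Fin n → Bool}
    (h : potTable y1 y0 = potTable y1' y0') :
    ∃ e : Equiv.Perm (Fin n), (∀ j, y1' (e j) = y1 j) ∧ ∀ j, y0' (e j) = y0 j := by
  simp only [potTable, Prod.mk.injEq] at h
  obtain ⟨h11, h10, h01, h00⟩ := h
  obtain ⟨e, he⟩ := exists_perm_apply_eq_of_card_fiber_eq
    (f := fun j => (y1 j, y0 j)) (g := fun j => (y1' j, y0' j)) (by
      rintro ⟨_ | _, _ | _⟩ <;> simpa only [Prod.mk.injEq])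
  simp only [Prod.mk.injEq] at he
  exact ⟨e, fun j => (he j).1, fun j => (he j).2⟩

theorem nObs11_map {n : ℕ} {y y' : Fin n → Bool} {e : Equiv.Perm (Fin n)}
    (he : ∀ j, y' (e j) = y j) (S : Finset (Fin n)) :
    nObs11 y' (S.map e.toEmbedding) = nObs11 y S := by
  simp [nObs11, filter_map, he]

theorem nObs01_map {n : ℕ} {y y' : Fin n → Bool} {e : Equiv.Perm (Fin n)}
    (he : ∀ j, y' (e j) = y j) (S : Finset (Fin n)) :
    nObs01 y' (S.map e.toEmbedding) = nObs01 y S := by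
  have hcompl : (S.map e.toEmbedding)ᶜ = Sᶜ.map e.toEmbedding := by
    ext j
    simp [mem_map_equiv]
  simp [nObs01, hcompl, filter_map, he]

/-- The randomization distribution of the estimator is determined by the potential table. -/
theorem card_filter_tauHat_eq {n : ℕ} (m : ℕ) {y1 y0 y1' y0' : Fin n → Bool}
    (h : potTable y1 y0 = potTable y1' y0') (P : ℚ → Prop) [DecidablePred P] :
    (((univ : Finset (Fin n)).powersetCard m).filter (fun S => P (tauHat m y1 y0 S))).card =
      (((univ : Finset (Fin n)).powersetCard m).filter
        (fun S => P (tauHat m y1' y0' S))).card := by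
  obtain ⟨e, h1, h0⟩ := exists_perm_of_potTable_eq h
  refine card_equiv e.finsetCongr fun S => ?_
  rw [mem_filter, mem_filter]
  simp [tauHat, nObs11_map h1, nObs01_map h0]

/-- potential outcomes with the same potential table give, for every
threshold `t`, the same number of assignments with `τ̂(S) ≥ t`; in particular the
one-sided and two-sided p-values depend on the potential outcomes only through the
potential table. -/
theorem pValue_depends_only_on_table (n m : ℕ) (hm : 0 < m) (hmn : m < n)
    (y1 y0 y1' y0' : Fin n → Bool)
    (h : potTable y1 y0 = potTable y1' y0') :
    ∀ t : ℚ,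
      ((((univ : Finset (Fin n)).powersetCard m).filter
          (fun S => t ≤ tauHat m y1 y0 S)).card =
        (((univ : Finset (Fin n)).powersetCard m).filter
          (fun S => t ≤ tauHat m y1' y0' S)).card) ∧
      pOne m t y1 y0 = pOne m t y1' y0' ∧
      pTwo m t y1 y0 = pTwo m t y1' y0' := by
  intro t
  have hτ : tauPO y1 y0 = tauPO y1' y0' := by simp only [tauPO, h]
  refine ⟨card_filter_tauHat_eq m h (t ≤ ·), ?_, ?_⟩
  · rw [pOne, pOne, card_filter_tauHat_eq m h (t ≤ ·)]
  · rw [pTwo, pTwo, hτ,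
      card_filter_tauHat_eq m h (fun x => |t - tauPO y1' y0'| ≤ |x - tauPO y1' y0'|)]
end

section
/- Let Δ ∈ T with associated pairs (a1, a2) and (b1, b2) given by: for Δ = (0,1,0,−1), (a1,a2) = (0,0) and (b1,b2) = (1,0); for Δ = (−1,1,0,0), (a1,a2) = (1,1) and (b1,b2) = (1,0); for Δ = (1,0,−1,0), (a1,a2) = (0,1) and (b1,b2) = (1,1); for Δ = (0,0,−1,1), (a1,a2) = (0,1) and (b1,b2) = (0,0). If N and N' = N + Δ are both potential tables on n units (all entries nonnegative, summing to n), then there exist potential outcomes (y1, y0) with potential table N, potential outcomes (y1', y0') with potential table N', and a unit r ∈ Fin n such that (y1(r), y0(r)) = (a1, a2), (y1'(r), y0'(r)) = (b1, b2), and (y1(j), y0(j)) = (y1'(j), y0'(j)) for all j ≠ r. -/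
open Finset

/-- Adjoining a unit with outcomes `(a, b)` increments the matching entry of the table. -/
theorem potTable_cons {n : ℕ} (a b : Bool) (y1 y0 : Fin n → Bool) :
    potTable (Fin.cons a y1 : Fin (n + 1) → Bool) (Fin.cons b y0) =
      ((potTable y1 y0).1 + if a = true ∧ b = true then 1 else 0,
       (potTable y1 y0).2.1 + if a = true ∧ b = false then 1 else 0,
       (potTable y1 y0).2.2.1 + if a = false ∧ b = true then 1 else 0,
       (potTable y1 y0).2.2.2 + if a = false ∧ b = false then 1 else 0) := by
  unfold potTable
  simp only [Fin.card_filter_univ_succ, Fin.cons_zero, Fin.cons_succ]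
  cases a <;> cases b <;> simp

/-- Every table of natural numbers summing to `n` is realized by potential outcomes. -/
theorem exists_potTable_eq (n N11 N10 N01 N00 : ℕ) (h : N11 + N10 + N01 + N00 = n) :
    ∃ y1 y0 : Fin n → Bool, potTable y1 y0 = (N11, N10, N01, N00) := by
  induction n generalizing N11 N10 N01 N00 with
  | zero =>
    obtain ⟨rfl, rfl, rfl, rfl⟩ : N11 = 0 ∧ N10 = 0 ∧ N01 = 0 ∧ N00 = 0 := by omega
    exact ⟨Fin.elim0, Fin.elim0, by simp [potTable]⟩
  | succ n ih =>
    have hpos : 0 < N11 ∨ 0 < N10 ∨ 0 < N01 ∨ 0 < N00 := by omega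
    rcases hpos with hp | hp | hp | hp
    · obtain ⟨y1, y0, hy⟩ := ih (N11 - 1) N10 N01 N00 (by omega)
      exact ⟨Fin.cons true y1, Fin.cons true y0, by
        simp [potTable_cons, hy, Nat.sub_add_cancel hp]⟩
    · obtain ⟨y1, y0, hy⟩ := ih N11 (N10 - 1) N01 N00 (by omega)
      exact ⟨Fin.cons true y1, Fin.cons false y0, by
        simp [potTable_cons, hy, Nat.sub_add_cancel hp]⟩
    · obtain ⟨y1, y0, hy⟩ := ih N11 N10 (N01 - 1) N00 (by omega)
      exact ⟨Fin.cons false y1, Fin.cons true y0, by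
        simp [potTable_cons, hy, Nat.sub_add_cancel hp]⟩
    · obtain ⟨y1, y0, hy⟩ := ih N11 N10 N01 (N00 - 1) (by omega)
      exact ⟨Fin.cons false y1, Fin.cons false y0, by
        simp [potTable_cons, hy, Nat.sub_add_cancel hp]⟩

/-- Lemma A.1: if `N` and `N' = N + Δ` with `Δ ∈ T` are both
potential tables, then they can be realized by potential outcomes differing in
exactly one unit `r`, with the prescribed values at `r`. -/
theorem exists_coupling (n : ℕ) (Δ : ℤ × ℤ × ℤ × ℤ) (a1 a2 b1 b2 : Bool)
    (hcase :
      (Δ = (0, 1, 0, -1) ∧ (a1, a2) = (false, false) ∧ (b1, b2) = (true, false)) ∨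
      (Δ = (-1, 1, 0, 0) ∧ (a1, a2) = (true, true) ∧ (b1, b2) = (true, false)) ∨
      (Δ = (1, 0, -1, 0) ∧ (a1, a2) = (false, true) ∧ (b1, b2) = (true, true)) ∨
      (Δ = (0, 0, -1, 1) ∧ (a1, a2) = (false, true) ∧ (b1, b2) = (false, false)))
    (N11 N10 N01 N00 N11' N10' N01' N00' : ℕ)
    (hN : N11 + N10 + N01 + N00 = n) (hN' : N11' + N10' + N01' + N00' = n)
    (hadd : (N11' : ℤ) = (N11 : ℤ) + Δ.1 ∧ (N10' : ℤ) = (N10 : ℤ) + Δ.2.1 ∧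
            (N01' : ℤ) = (N01 : ℤ) + Δ.2.2.1 ∧ (N00' : ℤ) = (N00 : ℤ) + Δ.2.2.2) :
    ∃ (y1 y0 y1' y0' : Fin n → Bool) (r : Fin n),
      potTable y1 y0 = (N11, N10, N01, N00) ∧
      potTable y1' y0' = (N11', N10', N01', N00') ∧
      (y1 r, y0 r) = (a1, a2) ∧ (y1' r, y0' r) = (b1, b2) ∧
      ∀ j : Fin n, j ≠ r → (y1 j, y0 j) = (y1' j, y0' j) := by
  obtain ⟨k, rfl⟩ : ∃ k, n = k + 1 := by
    refine Nat.exists_eq_succ_of_ne_zero ?_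
    rintro rfl
    rcases hcase with ⟨rfl, -⟩ | ⟨rfl, -⟩ | ⟨rfl, -⟩ | ⟨rfl, -⟩ <;> simp only at hadd <;> omega
  obtain ⟨y1, y0, hy⟩ := exists_potTable_eq k (min N11 N11') (min N10 N10') (min N01 N01')
    (min N00 N00') (by
      rcases hcase with ⟨rfl, -⟩ | ⟨rfl, -⟩ | ⟨rfl, -⟩ | ⟨rfl, -⟩ <;> simp only at hadd <;> omega)
  refine ⟨Fin.cons a1 y1, Fin.cons a2 y0, Fin.cons b1 y1, Fin.cons b2 y0, 0,
    ?_, ?_, by simp, by simp, fun j hj => ?_⟩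
  · rw [potTable_cons, hy]
    rcases hcase with ⟨rfl, ha, -⟩ | ⟨rfl, ha, -⟩ | ⟨rfl, ha, -⟩ | ⟨rfl, ha, -⟩ <;>
      obtain ⟨rfl, rfl⟩ := Prod.mk.inj ha <;> simp at hadd ⊢ <;> omega
  · rw [potTable_cons, hy]
    rcases hcase with ⟨rfl, -, hb⟩ | ⟨rfl, -, hb⟩ | ⟨rfl, -, hb⟩ | ⟨rfl, -, hb⟩ <;>
      obtain ⟨rfl, rfl⟩ := Prod.mk.inj hb <;> simp at hadd ⊢ <;> omega
  · obtain ⟨i, rfl⟩ := Fin.exists_succ_eq.2 hj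
    simp
end

section
/- Assume 2m ≤ n. Let N and N' be potential tables on n units with N'11 = N11, N'10 = N10 and N'01 ≤ N01. Fix a rational threshold t. If τ(N) ≤ t and τ(N') ≤ t, then p2(N') ≥ p2(N). -/
open Finset

/-- Lowering the number of `(0, 1)` units does not increase the number of control successes. -/
theorem nObs01_canY0_mono {n : ℕ} (N11 N10 : ℕ) {a b : ℕ} (hab : a ≤ b) (S : Finset (Fin n)) :
    nObs01 (canY0 n N11 N10 a) S ≤ nObs01 (canY0 n N11 N10 b) S := by
  refine card_le_card fun j hj => ?_
  simp only [canY0, mem_filter, decide_eq_true_eq] at hj ⊢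
  exact ⟨hj.1, by omega⟩

/-- Lowering the number of `(0, 1)` units from `b` to `a` removes at most `b - a` control
successes. -/
theorem nObs01_canY0_add_le {n : ℕ} (N11 N10 : ℕ) {a b : ℕ} (hab : a ≤ b) (S : Finset (Fin n)) :
    nObs01 (canY0 n N11 N10 b) S + a ≤ nObs01 (canY0 n N11 N10 a) S + b := by
  have hcard : (univ.filter fun j : Fin n =>
      N11 + N10 + a ≤ j.val ∧ j.val < N11 + N10 + b).card ≤ b - a := by
    rw [← card_map Fin.valEmbedding]
    calc _ ≤ (Finset.Ico (N11 + N10 + a) (N11 + N10 + b)).card := by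
          refine card_le_card fun x hx => ?_
          simp only [mem_map, mem_filter, mem_univ, true_and, Fin.valEmbedding_apply] at hx
          obtain ⟨j, hj, rfl⟩ := hx
          exact mem_Ico.2 hj
      _ = b - a := by rw [Nat.card_Ico]; omega
  have hunion : nObs01 (canY0 n N11 N10 b) S ≤ nObs01 (canY0 n N11 N10 a) S +
      (univ.filter fun j : Fin n => N11 + N10 + a ≤ j.val ∧ j.val < N11 + N10 + b).card := by
    refine le_trans (card_le_card fun j hj => ?_) (card_union_le _ _)
    simp only [canY0, mem_filter, mem_union, mem_univ, true_and, decide_eq_true_eq] at hj ⊢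
    by_cases h : N11 + N10 + a ≤ j.val
    · by_cases h' : j.val < N11
      · exact Or.inl ⟨hj.1, Or.inl h'⟩
      · exact Or.inr (by omega)
    · exact Or.inl ⟨hj.1, by omega⟩
  omega

/-- Lemma A.4: if `2m ≤ n`, `N'11 = N11`, `N'10 = N10`,
`N'01 ≤ N01`, and both `τ(N) ≤ t`, `τ(N') ≤ t`, then `p2(N') ≥ p2(N)`. -/
theorem pTwo_mono_unbalanced (n m : ℕ) (hm : 0 < m) (h2m : 2 * m ≤ n) (t : ℚ)
    (N11 N10 N01 N00 N01' N00' : ℕ)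
    (hN : N11 + N10 + N01 + N00 = n) (hN' : N11 + N10 + N01' + N00' = n)
    (h01 : N01' ≤ N01)
    (htau : ((N10 : ℚ) - N01) / n ≤ t) (htau' : ((N10 : ℚ) - N01') / n ≤ t) :
    pTwoTable n m t N11 N10 N01 N00 ≤ pTwoTable n m t N11 N10 N01' N00' := by
  have hm' : (0 : ℚ) < m := by exact_mod_cast hm
  have h2 : 2 * (m : ℚ) ≤ n := by exact_mod_cast h2m
  have hn : (0 : ℚ) < n := by linarith
  have hnm : (0 : ℚ) < (n : ℚ) - m := by linarith
  unfold pTwoTable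
  refine div_le_div_of_nonneg_right ?_ (Nat.cast_nonneg _)
  refine Nat.cast_le.2 (card_le_card fun S hS => ?_)
  rw [mem_filter] at hS ⊢
  refine ⟨hS.1, ?_⟩
  have hle := hS.2
  have hmono : (nObs01 (canY0 n N11 N10 N01') S : ℚ) ≤ nObs01 (canY0 n N11 N10 N01) S :=
    Nat.cast_le.2 (nObs01_canY0_mono N11 N10 h01 S)
  have hadd : (nObs01 (canY0 n N11 N10 N01) S : ℚ) + N01' ≤
      nObs01 (canY0 n N11 N10 N01') S + N01 := by
    exact_mod_cast nObs01_canY0_add_le N11 N10 h01 S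
  rw [abs_of_nonneg (sub_nonneg.2 htau), le_abs] at hle
  rw [abs_of_nonneg (sub_nonneg.2 htau'), le_abs]
  unfold tauHat at hle ⊢
  rcases hle with hle | hle
  · left
    have := div_le_div_of_nonneg_right hmono hnm.le
    linarith
  · right
    have hk : (0 : ℚ) ≤ (N01 : ℚ) - N01' := sub_nonneg.2 (Nat.cast_le.2 h01)
    have hdiff : (nObs01 (canY0 n N11 N10 N01) S : ℚ) / ((n : ℚ) - m) -
        nObs01 (canY0 n N11 N10 N01') S / ((n : ℚ) - m) ≤ 2 * (((N01 : ℚ) - N01') / n) := by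
      calc _ ≤ ((N01 : ℚ) - N01') / ((n : ℚ) - m) := by
            rw [← sub_div]
            exact div_le_div_of_nonneg_right (by linarith) hnm.le
        _ ≤ 2 * (((N01 : ℚ) - N01') / n) := by
            rw [← mul_div_assoc, div_le_div_iff₀ hnm hn]
            nlinarith
    have htaus : ((N10 : ℚ) - N01') / n = ((N10 : ℚ) - N01) / n + ((N01 : ℚ) - N01') / n := by
      ring
    rw [htaus]
    linarith
end

section
/- Assume the experiment is balanced, n = 2m. Let N be a potential table and N' = N + Δ with Δ ∈ T = {(0,1,0,−1), (−1,1,0,0), (1,0,−1,0), (0,0,−1,1)}, both N and N' being potential tables on n units. Fix a rational threshold t. If τ(N) ≤ t and τ(N') ≤ t, then p2(N') ≥ p2(N). -/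
open Finset

/-- Number of units of `S` among the first `k` units. -/
def cardBelow {n : ℕ} (S : Finset (Fin n)) (k : ℕ) : ℕ :=
  (S.filter (fun j => j.val < k)).card

theorem cardBelow_succ {n : ℕ} (S : Finset (Fin n)) (k : ℕ) :
    cardBelow S (k + 1) = cardBelow S k ∨ cardBelow S (k + 1) = cardBelow S k + 1 := by
  have hle : cardBelow S k ≤ cardBelow S (k + 1) :=
    card_le_card (monotone_filter_right S fun j _ hj => by omega)
  have hlt : cardBelow S (k + 1) ≤ cardBelow S k + 1 := by
    unfold cardBelow
    have hsplit : S.filter (fun j => j.val < k + 1) ⊆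
        S.filter (fun j => j.val < k) ∪ S.filter (fun j => j.val = k) := by
      intro j
      simp only [mem_filter, mem_union]
      rintro ⟨hj, hlt⟩
      have : j.val < k ∨ j.val = k := by omega
      tauto
    have hone : (S.filter (fun j => j.val = k)).card ≤ 1 := by
      rw [card_le_one]
      intro a ha b hb
      simp only [mem_filter] at ha hb
      exact Fin.ext (by omega)
    have := card_le_card hsplit
    have := card_union_le (S.filter (fun j => j.val < k)) (S.filter (fun j => j.val = k))
    omega
  omega

theorem cardBelow_add_compl {n : ℕ} (S : Finset (Fin n)) {k : ℕ} (hk : k ≤ n) :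
    cardBelow S k + cardBelow Sᶜ k = k := by
  unfold cardBelow
  rw [← card_union_of_disjoint (disjoint_filter_filter disjoint_compl_right),
    ← filter_union, union_compl, Fin.card_filter_val_lt, min_eq_right hk]

theorem nObs11_canY1 {n : ℕ} (N11 N10 : ℕ) (S : Finset (Fin n)) :
    nObs11 (canY1 n N11 N10) S = cardBelow S (N11 + N10) := by
  simp [nObs11, canY1, cardBelow]

theorem nObs01_canY0 {n : ℕ} (N11 N10 N01 : ℕ) (S : Finset (Fin n)) :
    nObs01 (canY0 n N11 N10 N01) S + cardBelow Sᶜ (N11 + N10) =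
      cardBelow Sᶜ N11 + cardBelow Sᶜ (N11 + N10 + N01) := by
  simp only [nObs01, canY0, cardBelow, card_filter, ← sum_add_distrib, decide_eq_true_eq]
  refine sum_congr rfl fun j _ => ?_
  split_ifs <;> omega

/-- In a balanced experiment the centered estimator for the canonical potential outcomes is
determined by the number of treated units below the two cut points `N11` and
`N11 + N10 + N01`. -/
theorem tauHat_can_sub {n m N11 N10 N01 : ℕ} (hm : 0 < m) (hbal : n = 2 * m)
    (hle : N11 + N10 + N01 ≤ n) (S : Finset (Fin n)) :
    tauHat m (canY1 n N11 N10) (canY0 n N11 N10 N01) S - ((N10 : ℚ) - N01) / n =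
      (2 * (cardBelow S N11 + cardBelow S (N11 + N10 + N01) : ℚ)
        - (N11 + (N11 + N10 + N01))) / n := by
  have h01 := nObs01_canY0 (n := n) N11 N10 N01 S
  have hA := cardBelow_add_compl S (k := N11) (by omega)
  have hB := cardBelow_add_compl S hle
  have hC := cardBelow_add_compl S (k := N11 + N10) (by omega)
  have hm' : (m : ℚ) ≠ 0 := by positivity
  have hn : (n : ℚ) = 2 * m := by exact_mod_cast hbal
  have key : (nObs01 (canY0 n N11 N10 N01) S : ℚ) =
      N11 + N01 + cardBelow S (N11 + N10) - cardBelow S N11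
        - cardBelow S (N11 + N10 + N01) := by
    have : (nObs01 (canY0 n N11 N10 N01) S : ℤ) =
      N11 + N01 + cardBelow S (N11 + N10) - cardBelow S N11
        - cardBelow S (N11 + N10 + N01) := by omega
    exact_mod_cast this
  rw [tauHat, nObs11_canY1, key, hn, show (2 * m - m : ℚ) = m by ring]
  field_simp
  ring

/-- Lemma A.5: in balanced experiments (`n = 2m`), if `N' = N + Δ`
with `Δ ∈ T`, and both `τ(N) ≤ t` and `τ(N') ≤ t`, then `p2(N') ≥ p2(N)`. -/
theorem pTwo_mono_onemove_balanced (n m : ℕ) (hm : 0 < m) (hbal : n = 2 * m) (t : ℚ)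
    (Δ : ℤ × ℤ × ℤ × ℤ)
    (hΔ : Δ = (0, 1, 0, -1) ∨ Δ = (-1, 1, 0, 0) ∨ Δ = (1, 0, -1, 0) ∨ Δ = (0, 0, -1, 1))
    (N11 N10 N01 N00 N11' N10' N01' N00' : ℕ)
    (hN : N11 + N10 + N01 + N00 = n) (hN' : N11' + N10' + N01' + N00' = n)
    (hadd : (N11' : ℤ) = (N11 : ℤ) + Δ.1 ∧ (N10' : ℤ) = (N10 : ℤ) + Δ.2.1 ∧
            (N01' : ℤ) = (N01 : ℤ) + Δ.2.2.1 ∧ (N00' : ℤ) = (N00 : ℤ) + Δ.2.2.2)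
    (htau : ((N10 : ℚ) - N01) / n ≤ t) (htau' : ((N10' : ℚ) - N01') / n ≤ t) :
    pTwoTable n m t N11 N10 N01 N00 ≤ pTwoTable n m t N11' N10' N01' N00' := by
  have hn : (0 : ℚ) < n := by
    have : 0 < n := by omega
    exact_mod_cast this
  unfold pTwoTable
  refine div_le_div_of_nonneg_right (Nat.cast_le.2 (card_le_card
    (monotone_filter_right _ fun S _ h => ?_))) (by positivity)
  rw [tauHat_can_sub hm hbal (by omega), abs_of_nonneg (sub_nonneg.2 htau), abs_div,
    abs_of_pos hn, le_div_iff₀ hn, sub_mul, div_mul_cancel₀ _ hn.ne'] at h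
  rw [tauHat_can_sub hm hbal (by omega), abs_of_nonneg (sub_nonneg.2 htau'), abs_div,
    abs_of_pos hn, le_div_iff₀ hn, sub_mul, div_mul_cancel₀ _ hn.ne']
  have hτ : (N10' : ℤ) - N01' = N10 - N01 + 1 := by
    rcases hΔ with rfl | rfl | rfl | rfl <;> simp only at hadd <;> omega
  have hτ' : (N10' : ℚ) - N01' = N10 - N01 + 1 := by exact_mod_cast hτ
  have hD : |(2 * (cardBelow S N11 + cardBelow S (N11 + N10 + N01) : ℤ)
        - (N11 + (N11 + N10 + N01)))| ≤
      |(2 * (cardBelow S N11' + cardBelow S (N11' + N10' + N01') : ℤ)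
        - (N11' + (N11' + N10' + N01')))| + 1 := by
    simp only [Int.abs_eq_natAbs]
    rcases hΔ with rfl | rfl | rfl | rfl <;> simp only at hadd
    · have hA : N11' = N11 := by omega
      have hB : N11' + N10' + N01' = N11 + N10 + N01 + 1 := by omega
      have := cardBelow_succ S (N11 + N10 + N01)
      rw [hB, hA]
      omega
    · have hA : N11 = N11' + 1 := by omega
      have hB : N11' + N10' + N01' = N11 + N10 + N01 := by omega
      have := cardBelow_succ S N11'
      rw [hB, hA]
      omega
    · have hA : N11' = N11 + 1 := by omega
      have hB : N11' + N10' + N01' = N11 + N10 + N01 := by omega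
      have := cardBelow_succ S N11
      rw [hB, hA]
      omega
    · have hA : N11' = N11 := by omega
      have hB : N11 + N10 + N01 = N11' + N10' + N01' + 1 := by omega
      have := cardBelow_succ S (N11' + N10' + N01')
      rw [hB, ← hA]
      omega
  have hD' : |(2 * (cardBelow S N11 + cardBelow S (N11 + N10 + N01) : ℚ)
        - (N11 + (N11 + N10 + N01)))| ≤
      |(2 * (cardBelow S N11' + cardBelow S (N11' + N10' + N01') : ℚ)
        - (N11' + (N11' + N10' + N01')))| + 1 := by exact_mod_cast hD
  linarith
end

section
/- Assume the experiment is balanced, n = 2m. Let N and N' be potential tables on n units with N'11 = N11, N'10 ≥ N10 and N'01 ≤ N01. Fix a rational threshold t. If τ(N) ≤ t and τ(N') ≤ t, then p2(N') ≥ p2(N). -/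
open Finset

/-- The number of elements of `Fin n` below `a ≤ n` is `a`, as a sum of indicators. -/
lemma sum_fin_indicator_lt {n a : ℕ} (h : a ≤ n) :
    ∑ j : Fin n, (if j.val < a then (1 : ℚ) else 0) = a := by
  rw [Fin.sum_univ_eq_sum_range (fun i => if i < a then (1 : ℚ) else 0) n, Finset.sum_boole]
  congr 1
  have : (range n).filter (fun i => i < a) = range a := by
    ext i
    simp only [mem_filter, mem_range]
    omega
  rw [this, card_range]

/-- In a balanced experiment the centred estimator is, up to scaling, a signed sum in which
units of type `11` have weight `2`, units of types `10` and `01` have weight `1`, and the sign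
records the treatment assignment. -/
lemma two_mul_tauHat_sub_eq_signed_sum {n m : ℕ} (hm : 0 < m) (hbal : n = 2 * m)
    {N11 N10 N01 : ℕ} (hN : N11 + N10 + N01 ≤ n) (S : Finset (Fin n)) :
    2 * (m : ℚ) * (tauHat m (canY1 n N11 N10) (canY0 n N11 N10 N01) S - ((N10 : ℚ) - N01) / n) =
      ∑ j : Fin n, (if j ∈ S then (1 : ℚ) else -1) *
        ((if j.val < N11 then 1 else 0) + (if j.val < N11 + (N10 + N01) then 1 else 0)) := by
  have hmq : (m : ℚ) ≠ 0 := by positivity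
  have hnq : (n : ℚ) = 2 * m := by rw [hbal]; push_cast; ring
  have e11 : (nObs11 (canY1 n N11 N10) S : ℚ) =
      ∑ j : Fin n, if j ∈ S ∧ j.val < N11 + N10 then (1 : ℚ) else 0 := by
    rw [Finset.sum_boole, nObs11]
    congr 2
    ext j
    simp [canY1]
  have e01 : (nObs01 (canY0 n N11 N10 N01) S : ℚ) =
      ∑ j : Fin n, if j ∉ S ∧ (j.val < N11 ∨ (N11 + N10 ≤ j.val ∧ j.val < N11 + N10 + N01))
        then (1 : ℚ) else 0 := by
    rw [Finset.sum_boole, nObs01]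
    congr 2
    ext j
    simp [canY0]
  have s1 := sum_fin_indicator_lt (n := n) (a := N11) (by omega)
  have s2 := sum_fin_indicator_lt (n := n) (a := N11 + N10) (by omega)
  have s3 := sum_fin_indicator_lt (n := n) (a := N11 + N10 + N01) (by omega)
  have hD : (N10 : ℚ) - N01 = 2 * ((N11 + N10 : ℕ) : ℚ) - N11 - ((N11 + N10 + N01 : ℕ) : ℚ) := by
    push_cast; ring
  have hlhs : 2 * (m : ℚ) *
      (tauHat m (canY1 n N11 N10) (canY0 n N11 N10 N01) S - ((N10 : ℚ) - N01) / n) =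
      2 * nObs11 (canY1 n N11 N10) S - 2 * nObs01 (canY0 n N11 N10 N01) S
        - ((N10 : ℚ) - N01) := by
    rw [tauHat, hnq, show 2 * (m : ℚ) - m = m by ring]
    field_simp
  rw [hlhs, hD, e11, e01, ← s1, ← s2, ← s3]
  simp only [Finset.mul_sum, ← Finset.sum_sub_distrib]
  refine Finset.sum_congr rfl fun j _ => ?_
  by_cases hS : j ∈ S <;> by_cases h1 : j.val < N11 <;> by_cases h2 : j.val < N11 + N10 <;>
    by_cases h3 : j.val < N11 + N10 + N01 <;>
    first
    | omega
    | (have h3' : ¬ j.val < N11 + (N10 + N01) := by omega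
       have h2' : N11 + N10 ≤ j.val := by omega
       simp only [hS, h1, h2, h3, h3', h2']; norm_num)
    | (have h3' : j.val < N11 + (N10 + N01) := by omega
       have h2' : N11 + N10 ≤ j.val := by omega
       simp only [hS, h1, h2, h3, h3', h2']; norm_num)
    | (have h3' : j.val < N11 + (N10 + N01) := by omega
       have h2' : ¬ N11 + N10 ≤ j.val := by omega
       simp only [hS, h1, h2, h3, h3', h2']; norm_num)

/-- A signed sum over the units below a bound changes by at most the change of the bound. -/
lemma abs_signed_sum_sub_le {n a b : ℕ} (hab : a ≤ b) (hb : b ≤ n) (S : Finset (Fin n)) :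
    |∑ j : Fin n, (if j ∈ S then (1 : ℚ) else -1) * (if j.val < b then 1 else 0) -
      ∑ j : Fin n, (if j ∈ S then (1 : ℚ) else -1) * (if j.val < a then 1 else 0)| ≤
      (b : ℚ) - a := by
  rw [← sum_fin_indicator_lt hb, ← sum_fin_indicator_lt (hab.trans hb),
    ← Finset.sum_sub_distrib, ← Finset.sum_sub_distrib]
  refine (Finset.abs_sum_le_sum_abs _ _).trans (Finset.sum_le_sum fun j _ => ?_)
  by_cases hS : j ∈ S <;> by_cases h1 : j.val < a <;> by_cases h2 : j.val < b <;>
    first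
    | omega
    | simp [hS, h1, h2]

/-- Lemma A.6: in balanced experiments (`n = 2m`), if
`N'11 = N11`, `N'10 ≥ N10`, `N'01 ≤ N01`, and both `τ(N) ≤ t`, `τ(N') ≤ t`, then
`p2(N') ≥ p2(N)`. -/
theorem pTwo_mono_balanced (n m : ℕ) (hm : 0 < m) (hbal : n = 2 * m) (t : ℚ)
    (N11 N10 N01 N00 N10' N01' N00' : ℕ)
    (hN : N11 + N10 + N01 + N00 = n) (hN' : N11 + N10' + N01' + N00' = n)
    (h10 : N10 ≤ N10') (h01 : N01' ≤ N01)
    (htau : ((N10 : ℚ) - N01) / n ≤ t) (htau' : ((N10' : ℚ) - N01') / n ≤ t) :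
    pTwoTable n m t N11 N10 N01 N00 ≤ pTwoTable n m t N11 N10' N01' N00' := by
  have hmq : (0 : ℚ) < 2 * m := by positivity
  have hnq : (n : ℚ) = 2 * m := by rw [hbal]; push_cast; ring
  unfold pTwoTable
  refine div_le_div_of_nonneg_right (Nat.cast_le.mpr (Finset.card_le_card ?_)) (Nat.cast_nonneg _)
  refine Finset.monotone_filter_right _ fun S _ h => ?_
  have scale (x : ℚ) : 2 * (m : ℚ) * |x| = |2 * m * x| := by rw [abs_mul, abs_of_pos hmq]
  rw [abs_of_nonneg (sub_nonneg.mpr htau)] at h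
  rw [abs_of_nonneg (sub_nonneg.mpr htau')]
  refine le_of_mul_le_mul_left ?_ hmq
  have h := mul_le_mul_of_nonneg_left h hmq.le
  rw [scale, two_mul_tauHat_sub_eq_signed_sum hm hbal (by omega)] at h
  rw [scale, two_mul_tauHat_sub_eq_signed_sum hm hbal (by omega)]
  simp only [mul_add (ite _ _ _), Finset.sum_add_distrib] at h ⊢
  have t1 : 2 * (m : ℚ) * (t - ((N10 : ℚ) - N01) / n) = 2 * m * t - (N10 - N01) := by
    rw [hnq]; field_simp
  have t2 : 2 * (m : ℚ) * (t - ((N10' : ℚ) - N01') / n) = 2 * m * t - (N10' - N01') := by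
    rw [hnq]; field_simp
  rw [t1] at h
  rw [t2]
  set P := ∑ j : Fin n, (if j ∈ S then (1 : ℚ) else -1) * (if j.val < N11 then 1 else 0)
  set Q := ∑ j : Fin n, (if j ∈ S then (1 : ℚ) else -1) *
    (if j.val < N11 + (N10 + N01) then 1 else 0) with hQ
  set Q' := ∑ j : Fin n, (if j ∈ S then (1 : ℚ) else -1) *
    (if j.val < N11 + (N10' + N01') then 1 else 0) with hQ'
  have c10 : (N10 : ℚ) ≤ N10' := by exact_mod_cast h10
  have c01 : (N01' : ℚ) ≤ N01 := by exact_mod_cast h01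
  have hQQ : |Q - Q'| ≤ (N10' - N10) + (N01 - N01') := by
    rcases le_total (N10 + N01) (N10' + N01') with hle | hle
    · have := abs_signed_sum_sub_le (Nat.add_le_add_left hle N11) (by omega) S
      rw [← hQ, ← hQ', abs_sub_comm] at this
      push_cast at this
      linarith
    · have := abs_signed_sum_sub_le (Nat.add_le_add_left hle N11) (by omega) S
      rw [← hQ, ← hQ'] at this
      push_cast at this
      linarith
  have htri : |P + Q| ≤ |P + Q'| + |Q - Q'| := by
    simpa using abs_add_le (P + Q') (Q - Q')
  linarith
end

section
/- Let 0 < m < n. If N and N' = N + Δ are both potential tables on n units with Δ ∈ T = {(0,1,0,−1), (−1,1,0,0), (1,0,−1,0), (0,0,−1,1)}, then for every rational threshold t, p1(N') ≥ p1(N). -/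
open Finset

/-- Relabelling the units by `σ` so that `y1` weakly increases and `y0` weakly decreases
weakly increases the one-sided p-value. -/
theorem pOne_le_pOne_of_perm {n m : ℕ} (hmn : m ≤ n) (t : ℚ) {y1 y0 y1' y0' : Fin n → Bool}
    (σ : Equiv.Perm (Fin n)) (h1 : ∀ j, y1 (σ j) = true → y1' j = true)
    (h0 : ∀ j, y0' j = true → y0 (σ j) = true) :
    pOne m t y1 y0 ≤ pOne m t y1' y0' := by
  unfold pOne
  refine div_le_div_of_nonneg_right (Nat.cast_le.mpr ?_) (Nat.cast_nonneg _)
  refine Finset.card_le_card_of_injOn (fun S => S.map σ.symm.toEmbedding) ?_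
    (fun S _ T _ h => Finset.map_injective _ h)
  intro S hS
  simp only [Finset.coe_filter, Set.mem_ofPred_eq, Finset.mem_powersetCard, Finset.subset_univ,
    true_and, Finset.card_map] at hS ⊢
  refine ⟨hS.1, hS.2.trans ?_⟩
  have hle1 : nObs11 y1 S ≤ nObs11 y1' (S.map σ.symm.toEmbedding) := by
    refine Finset.card_le_card_of_injOn σ.symm (fun j hj => ?_) σ.symm.injective.injOn
    simp only [Finset.coe_filter, Set.mem_ofPred_eq] at hj ⊢
    exact ⟨Finset.mem_map_of_mem σ.symm.toEmbedding hj.1, h1 _ (by simpa using hj.2)⟩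
  have hle0 : nObs01 y0' (S.map σ.symm.toEmbedding) ≤ nObs01 y0 S := by
    refine Finset.card_le_card_of_injOn σ (fun j hj => ?_) σ.injective.injOn
    simp only [Finset.coe_filter, Set.mem_ofPred_eq, Finset.mem_compl] at hj ⊢
    exact ⟨fun h => hj.1 (by simpa using Finset.mem_map_of_mem σ.symm.toEmbedding h),
      h0 _ hj.2⟩
  have hnm : (0 : ℚ) ≤ (n : ℚ) - m := sub_nonneg.mpr (by exact_mod_cast hmn)
  unfold tauHat
  gcongr

/-- Lemma A.7: if `N' = N + Δ` with `Δ ∈ T`, then for every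
threshold `t`, `p1(N') ≥ p1(N)`. -/
theorem pOne_mono_onemove (n m : ℕ) (hm : 0 < m) (hmn : m < n)
    (Δ : ℤ × ℤ × ℤ × ℤ)
    (hΔ : Δ = (0, 1, 0, -1) ∨ Δ = (-1, 1, 0, 0) ∨ Δ = (1, 0, -1, 0) ∨ Δ = (0, 0, -1, 1))
    (N11 N10 N01 N00 N11' N10' N01' N00' : ℕ)
    (hN : N11 + N10 + N01 + N00 = n) (hN' : N11' + N10' + N01' + N00' = n)
    (hadd : (N11' : ℤ) = (N11 : ℤ) + Δ.1 ∧ (N10' : ℤ) = (N10 : ℤ) + Δ.2.1 ∧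
            (N01' : ℤ) = (N01 : ℤ) + Δ.2.2.1 ∧ (N00' : ℤ) = (N00 : ℤ) + Δ.2.2.2) :
    ∀ t : ℚ, pOneTable n m t N11 N10 N01 N00 ≤ pOneTable n m t N11' N10' N01' N00' := by
  intro t
  obtain ⟨e11, e10, e01, e00⟩ := hadd
  rcases hΔ with rfl | rfl | rfl | rfl <;> simp only at e11 e10 e01 e00
  · refine pOne_le_pOne_of_perm hmn.le t
      (Equiv.swap ⟨N11 + N10, by omega⟩ ⟨N11 + N10 + N01, by omega⟩)
      (fun j => ?_) (fun j => ?_) <;>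
    · simp only [canY1, canY0, decide_eq_true_eq, Equiv.swap_apply_def, Fin.ext_iff]
      split_ifs <;> try dsimp only
      all_goals omega
  · refine pOne_le_pOne_of_perm hmn.le t (Equiv.refl _) (fun j => ?_) (fun j => ?_) <;>
    · simp only [Equiv.refl_apply]
      simp only [canY1, canY0, decide_eq_true_eq]
      omega
  · refine pOne_le_pOne_of_perm hmn.le t
      (Equiv.swap ⟨N11, by omega⟩ ⟨N11 + N10, by omega⟩)
      (fun j => ?_) (fun j => ?_) <;>
    · simp only [canY1, canY0, decide_eq_true_eq, Equiv.swap_apply_def, Fin.ext_iff]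
      split_ifs <;> try dsimp only
      all_goals omega
  · refine pOne_le_pOne_of_perm hmn.le t (Equiv.refl _) (fun j => ?_) (fun j => ?_) <;>
    · simp only [Equiv.refl_apply]
      simp only [canY1, canY0, decide_eq_true_eq]
      omega
end

section
/- Let 0 < m < n. If N and N' are potential tables on n units with N'11 = N11, N'10 ≥ N10 and N'01 ≤ N01, then for every rational threshold t, p1(N') ≥ p1(N). -/
open Finset

/-- The one-sided p-value is invariant under relabelling the units. -/
theorem pOne_comp_perm {n : ℕ} (m : ℕ) (t : ℚ) (y1 y0 : Fin n → Bool)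
    (σ : Equiv.Perm (Fin n)) : pOne m t (y1 ∘ σ) (y0 ∘ σ) = pOne m t y1 y0 := by
  have hτ (S : Finset (Fin n)) :
      tauHat m (y1 ∘ σ) (y0 ∘ σ) S = tauHat m y1 y0 (S.map σ.toEmbedding) := by
    have h1 : nObs11 (y1 ∘ σ) S = nObs11 y1 (S.map σ.toEmbedding) := by
      simp only [nObs11, filter_map, card_map]
      rfl
    have hc : (S.map σ.toEmbedding)ᶜ = Sᶜ.map σ.toEmbedding := by
      ext j
      simp [mem_map_equiv]
    have h0 : nObs01 (y0 ∘ σ) S = nObs01 y0 (S.map σ.toEmbedding) := by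
      simp only [nObs01, hc, filter_map, card_map]
      rfl
    rw [tauHat, tauHat, h1, h0]
  unfold pOne
  congr 2
  refine card_equiv σ.finsetCongr fun S => ?_
  simp [hτ]

/-- The one-sided p-value increases when treatment outcomes increase and control outcomes
decrease, unit by unit. -/
theorem pOne_le_pOne_of_imp {n m : ℕ} (hmn : m < n) (t : ℚ) {y1 y0 y1' y0' : Fin n → Bool}
    (h1 : ∀ j, y1 j = true → y1' j = true) (h0 : ∀ j, y0' j = true → y0 j = true) :
    pOne m t y1 y0 ≤ pOne m t y1' y0' := by
  have hpos : (0 : ℚ) ≤ (n : ℚ) - m := sub_nonneg.2 (by exact_mod_cast hmn.le)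
  have hτ (S : Finset (Fin n)) : tauHat m y1 y0 S ≤ tauHat m y1' y0' S := by
    have h11 : nObs11 y1 S ≤ nObs11 y1' S :=
      card_le_card (monotone_filter_right S fun j _ => h1 j)
    have h01 : nObs01 y0' S ≤ nObs01 y0 S :=
      card_le_card (monotone_filter_right Sᶜ fun j _ => h0 j)
    unfold tauHat
    gcongr
  unfold pOne
  gcongr with S
  exact hτ S

/-- The permutation of `Fin n` fixing the units below `a` and reversing the others. -/
def tailRev (n a : ℕ) : Equiv.Perm (Fin n) :=
  Function.Involutive.toPerm
    (fun j => ⟨if j.val < a then j.val else a + (n - 1 - j.val), by split <;> omega⟩)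
    (fun j => by ext; dsimp only; split_ifs <;> omega)

theorem val_tailRev (n a : ℕ) (j : Fin n) :
    (tailRev n a j).val = if j.val < a then j.val else a + (n - 1 - j.val) := rfl

/-- The p-value of a table, computed with the units of type `(0, 1)` placed last. -/
theorem pOneTable_eq_pOne_last (n m : ℕ) (t : ℚ) (N11 N10 N01 N00 : ℕ)
    (hN : N11 + N10 + N01 + N00 = n) :
    pOneTable n m t N11 N10 N01 N00 =
      pOne m t (canY1 n N11 N10) (fun j => decide (j.val < N11 ∨ n - N01 ≤ j.val)) := by
  rw [pOneTable, ← pOne_comp_perm m t _ _ (tailRev n (N11 + N10))]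
  congr 1 <;> funext j
  · rw [Function.comp_apply, canY1, canY1, decide_eq_decide, val_tailRev]
    split_ifs <;> omega
  · rw [Function.comp_apply, canY0, decide_eq_decide, val_tailRev]
    split_ifs <;> omega

/-- Lemma A.8: if `N'11 = N11`, `N'10 ≥ N10`, `N'01 ≤ N01`, then
for every threshold `t`, `p1(N') ≥ p1(N)`. -/
theorem pOne_mono (n m : ℕ) (hm : 0 < m) (hmn : m < n)
    (N11 N10 N01 N00 N10' N01' N00' : ℕ)
    (hN : N11 + N10 + N01 + N00 = n) (hN' : N11 + N10' + N01' + N00' = n)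
    (h10 : N10 ≤ N10') (h01 : N01' ≤ N01) :
    ∀ t : ℚ, pOneTable n m t N11 N10 N01 N00 ≤ pOneTable n m t N11 N10' N01' N00' := by
  intro t
  rw [pOneTable_eq_pOne_last n m t _ _ _ _ hN, pOneTable_eq_pOne_last n m t _ _ _ _ hN']
  refine pOne_le_pOne_of_imp hmn t (fun j => ?_) (fun j => ?_)
  · simp only [canY1, decide_eq_true_eq]
    omega
  · simp only [decide_eq_true_eq]
    omega
end

section
/- Assume the experiment is balanced, n = 2m, fix α ∈ (0,1) and a rational t. For nonnegative integers N11, N01 with N11 + N01 ≤ n, define N̲10(N11, N01) as the minimum N10 ∈ {0, …, n − N11 − N01} such that the potential table N = (N11, N10, N01, n − N11 − N10 − N01) satisfies p2(N) ≥ α and τ(N) ≤ t; if no such N10 exists, set N̲10(N11, N01) = ⌊N01 + n·t⌋ + 1. Then for every potential table N = (N11, N10, N01, N00) with τ(N) ≤ t, one has p2(N) ≥ α if and only if N10 ≥ N̲10(N11, N01). -/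
open Finset

/-- `N̲10(N11, N01)`: the minimum `N10 ∈ {0, …, n - N11 - N01}` such that the
potential table `(N11, N10, N01, n - N11 - N10 - N01)` satisfies `p2(N) ≥ α` and
`τ(N) ≤ t`; if no such `N10` exists, it is `⌊N01 + n·t⌋ + 1`. -/
def lowN10Two (n m : ℕ) (t α : ℚ) (N11 N01 : ℕ) : ℤ :=
  let s := (Finset.range (n - N11 - N01 + 1)).filter
    (fun N10 => α ≤ pTwoTable n m t N11 N10 N01 (n - N11 - N10 - N01) ∧
      ((N10 : ℚ) - N01) / n ≤ t)
  if h : s.Nonempty then ((s.min' h : ℕ) : ℤ) else ⌊(N01 : ℚ) + n * t⌋ + 1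

/-- The observed count difference as a sum over the treated units. -/
lemma nObs11_sub_nObs01 {n : ℕ} (y1 y0 : Fin n → Bool) (S : Finset (Fin n)) :
    (nObs11 y1 S : ℚ) - nObs01 y0 S =
      (∑ j ∈ S, ((if y1 j = true then (1 : ℚ) else 0) + if y0 j = true then 1 else 0)) -
        (univ.filter (fun j => y0 j = true)).card := by
  have h := Finset.sum_add_sum_compl S (fun j => if y0 j = true then (1 : ℚ) else 0)
  simp only [nObs11, nObs01, Finset.card_filter, Nat.cast_sum, Nat.cast_ite, Nat.cast_one,
    Nat.cast_zero, Finset.sum_add_distrib]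
  linarith

lemma card_canY0 {n N11 N10 N01 : ℕ} (h : N11 + N10 + N01 ≤ n) :
    (univ.filter (fun j : Fin n => canY0 n N11 N10 N01 j = true)).card = N11 + N01 := by
  have hmap : (univ.filter (fun j : Fin n => canY0 n N11 N10 N01 j = true)).map Fin.valEmbedding =
      range N11 ∪ Ico (N11 + N10) (N11 + N10 + N01) := by
    ext k
    simp only [canY0, decide_eq_true_eq, mem_map, mem_filter, mem_univ, true_and,
      Fin.valEmbedding_apply, mem_union, mem_range, mem_Ico]
    constructor
    · rintro ⟨j, hj, rfl⟩
      exact hj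
    · intro hk
      exact ⟨⟨k, by omega⟩, hk, rfl⟩
  have hdisj : Disjoint (range N11) (Ico (N11 + N10) (N11 + N10 + N01)) := by
    rw [Finset.disjoint_left]
    intro k
    simp only [mem_range, mem_Ico]
    omega
  rw [← card_map Fin.valEmbedding, hmap, card_union_of_disjoint hdisj, card_range, Nat.card_Ico]
  omega

/-- Moving one unit from the `00` cell to the `10` cell raises the observed count difference
by one exactly when that unit is treated. -/
lemma nObs_can_succ {n N11 N10 N01 : ℕ} (h : N11 + N10 + N01 < n) (S : Finset (Fin n)) :
    (nObs11 (canY1 n N11 (N10 + 1)) S : ℚ) - nObs01 (canY0 n N11 (N10 + 1) N01) S =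
      (nObs11 (canY1 n N11 N10) S : ℚ) - nObs01 (canY0 n N11 N10 N01) S +
        if (⟨N11 + N10 + N01, h⟩ : Fin n) ∈ S then 1 else 0 := by
  rw [nObs11_sub_nObs01, nObs11_sub_nObs01, card_canY0 (by omega), card_canY0 (by omega),
    ← Finset.sum_ite_eq' S (⟨N11 + N10 + N01, h⟩ : Fin n) (fun _ => (1 : ℚ)), sub_add_eq_add_sub,
    ← Finset.sum_add_distrib]
  congr 1
  refine Finset.sum_congr rfl fun j _ => ?_
  simp only [canY1, canY0, decide_eq_true_eq, Fin.ext_iff]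
  split_ifs <;> first | omega | norm_num

lemma pTwoTable_le_succ {n m : ℕ} (hm : 0 < m) (hbal : n = 2 * m) {t : ℚ}
    {N11 N10 N01 : ℕ} (h : N11 + N10 + N01 < n)
    (htau : (((N10 + 1 : ℕ) : ℚ) - N01) / n ≤ t) (N00 N00' : ℕ) :
    pTwoTable n m t N11 N10 N01 N00 ≤ pTwoTable n m t N11 (N10 + 1) N01 N00' := by
  unfold pTwoTable
  refine div_le_div_of_nonneg_right (Nat.cast_le.mpr (card_le_card
    (monotone_filter_right _ fun S _ hx => ?_))) (Nat.cast_nonneg _)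
  have hm' : (0 : ℚ) < m := by exact_mod_cast hm
  have hn : (n : ℚ) = 2 * m := by exact_mod_cast hbal
  have hnm : (n : ℚ) - m = m := by linarith
  set δ : ℚ := 1 / (2 * m)
  have hδ : 0 < δ := by positivity
  have hτ : (((N10 + 1 : ℕ) : ℚ) - N01) / n = ((N10 : ℚ) - N01) / n + δ := by
    rw [hn]; push_cast; simp only [δ]; ring
  have hhat : tauHat m (canY1 n N11 (N10 + 1)) (canY0 n N11 (N10 + 1) N01) S =
      tauHat m (canY1 n N11 N10) (canY0 n N11 N10 N01) S +
        2 * δ * if (⟨N11 + N10 + N01, h⟩ : Fin n) ∈ S then 1 else 0 := by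
    have h2 : 2 * δ = 1 / m := by simp only [δ]; field_simp
    rw [tauHat, tauHat, hnm, ← sub_div, ← sub_div, nObs_can_succ h, add_div, h2]
    ring
  rw [hτ] at htau ⊢
  rw [hhat]
  rw [abs_of_nonneg (by linarith)] at hx ⊢
  rcases le_abs.mp hx with hx | hx
  · refine le_abs.mpr (Or.inl ?_)
    split_ifs <;> linarith
  · refine le_abs.mpr (Or.inr ?_)
    split_ifs <;> linarith

/-- In balanced experiments, below the threshold the two-sided p-value is nondecreasing
in `N10` for fixed `N11` and `N01`. -/
lemma pTwoTable_mono {n m : ℕ} (hm : 0 < m) (hbal : n = 2 * m) {t : ℚ}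
    {N11 N01 a b : ℕ} (hab : a ≤ b) (h : N11 + b + N01 ≤ n)
    (htau : ((b : ℚ) - N01) / n ≤ t) (N00 N00' : ℕ) :
    pTwoTable n m t N11 a N01 N00 ≤ pTwoTable n m t N11 b N01 N00' := by
  induction b, hab using Nat.le_induction with
  | base => exact le_rfl
  | succ b _ ih =>
    refine (ih (by omega) (le_trans ?_ htau)).trans
      (pTwoTable_le_succ hm hbal (by omega) htau N00' N00')
    gcongr
    simp

/-- Theorem 2(2): in balanced experiments, a potential table `N`
with `τ(N) ≤ t` has `p2(N) ≥ α` iff `N10 ≥ N̲10(N11, N01)`. -/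
theorem pTwo_ge_iff_lowN10Two (n m : ℕ) (hm : 0 < m) (hbal : n = 2 * m) (α t : ℚ)
    (hα : 0 < α ∧ α < 1) (N11 N10 N01 N00 : ℕ) (hN : N11 + N10 + N01 + N00 = n)
    (htau : ((N10 : ℚ) - N01) / n ≤ t) :
    α ≤ pTwoTable n m t N11 N10 N01 N00 ↔ lowN10Two n m t α N11 N01 ≤ (N10 : ℤ) := by
  have hn : (0 : ℚ) < n := by
    rw [hbal]
    positivity
  rw [lowN10Two]
  split_ifs with hs
  · refine ⟨fun h => Int.ofNat_le.mpr (min'_le _ _ (mem_filter.mpr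
      ⟨mem_range.mpr (by omega), h, htau⟩)), fun h => ?_⟩
    exact (mem_filter.mp (min'_mem _ hs)).2.1.trans
      (pTwoTable_mono hm hbal (Int.ofNat_le.mp h) (by omega) htau _ _)
  · refine ⟨fun h => absurd ⟨N10, mem_filter.mpr ⟨mem_range.mpr (by omega), h, htau⟩⟩ hs,
      fun h => absurd (Int.add_one_le_iff.mp h) ?_⟩
    rw [not_lt, Int.le_floor, Int.cast_natCast]
    rw [div_le_iff₀ hn] at htau
    linarith
end

section
/- Let 0 < m < n, fix α ∈ (0,1) and a rational threshold t. For nonnegative integers N11, N01 with N11 + N01 ≤ n, define N̲10¹(N11, N01) as the minimum N10 ∈ {0, …, n − N11 − N01} such that the potential table N = (N11, N10, N01, n − N11 − N10 − N01) satisfies p1(N) ≥ α; if no such N10 exists, set N̲10¹(N11, N01) = n + 1. Then N̲10¹ is monotone in its second argument: if N01 ≤ N01' and N11 + N01' ≤ n, then N̲10¹(N11, N01) ≤ N̲10¹(N11, N01'). -/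
open Finset

/-- `N̲10¹(N11, N01)`: the minimum `N10 ∈ {0, …, n - N11 - N01}` such that the
potential table `(N11, N10, N01, n - N11 - N10 - N01)` satisfies `p1(N) ≥ α`; if no
such `N10` exists, it is `n + 1`. -/
def lowN10One (n m : ℕ) (t α : ℚ) (N11 N01 : ℕ) : ℤ :=
  let s := (Finset.range (n - N11 - N01 + 1)).filter
    (fun N10 => α ≤ pOneTable n m t N11 N10 N01 (n - N11 - N10 - N01))
  if h : s.Nonempty then ((s.min' h : ℕ) : ℤ) else (n : ℤ) + 1

theorem nObs01_mono {n : ℕ} {y0 y0' : Fin n → Bool} (h : ∀ j, y0 j = true → y0' j = true)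
    (S : Finset (Fin n)) : nObs01 y0 S ≤ nObs01 y0' S :=
  card_le_card (monotone_filter_right _ fun j _ hj => h j hj)

theorem tauHat_antitone_control {n m : ℕ} (hmn : m ≤ n) (y1 : Fin n → Bool)
    {y0 y0' : Fin n → Bool} (h : ∀ j, y0 j = true → y0' j = true) (S : Finset (Fin n)) :
    tauHat m y1 y0' S ≤ tauHat m y1 y0 S := by
  have hnm : (0 : ℚ) ≤ (n : ℚ) - m := sub_nonneg.mpr (by exact_mod_cast hmn)
  have hle : (nObs01 y0 S : ℚ) ≤ nObs01 y0' S := by exact_mod_cast nObs01_mono h S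
  exact sub_le_sub_left (div_le_div_of_nonneg_right hle hnm) _

theorem pOne_antitone_control {n m : ℕ} (hmn : m ≤ n) (t : ℚ) (y1 : Fin n → Bool)
    {y0 y0' : Fin n → Bool} (h : ∀ j, y0 j = true → y0' j = true) :
    pOne m t y1 y0' ≤ pOne m t y1 y0 := by
  refine div_le_div_of_nonneg_right (Nat.cast_le.mpr (card_le_card ?_)) (Nat.cast_nonneg _)
  exact monotone_filter_right _ fun S _ hS => hS.trans (tauHat_antitone_control hmn y1 h S)

theorem canY0_mono (n N11 N10 : ℕ) {N01 N01' : ℕ} (h : N01 ≤ N01') (j : Fin n)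
    (hj : canY0 n N11 N10 N01 j = true) : canY0 n N11 N10 N01' j = true := by
  simp only [canY0, decide_eq_true_eq] at hj ⊢
  omega

/-- Theorem A.1(1): `N̲10¹(N11, ·)` is monotone. -/
theorem lowN10One_mono (n m : ℕ) (hm : 0 < m) (hmn : m < n) (α t : ℚ)
    (hα : 0 < α ∧ α < 1) (N11 N01 N01' : ℕ) (h01 : N01 ≤ N01') (hsum : N11 + N01' ≤ n) :
    lowN10One n m t α N11 N01 ≤ lowN10One n m t α N11 N01' := by
  have hsub : (range (n - N11 - N01' + 1)).filter
        (fun N10 => α ≤ pOneTable n m t N11 N10 N01' (n - N11 - N10 - N01')) ⊆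
      (range (n - N11 - N01 + 1)).filter
        (fun N10 => α ≤ pOneTable n m t N11 N10 N01 (n - N11 - N10 - N01)) := by
    intro N10 hN
    rw [mem_filter, mem_range] at hN ⊢
    exact ⟨by omega, hN.2.trans
      (pOne_antitone_control hmn.le t _ (canY0_mono n N11 N10 h01))⟩
  unfold lowN10One
  dsimp only
  split_ifs with h h' h'
  · exact_mod_cast min'_subset h' hsub
  · have hmin := mem_range.mp (mem_filter.mp (min'_mem _ h)).1
    omega
  · exact absurd (h'.mono hsub) h
  · exact le_rfl
end

section
/- Let 0 < m < n and fix an observed table (n11, n10, n01, n00) with n11 + n10 = m and total sum n. If a potential table N = (N11, N10, N01, N00) is compatible with the observed table and N10 − N01 < n11 + n00, then there exists Δ ∈ T = {(0,1,0,−1), (−1,1,0,0), (1,0,−1,0), (0,0,−1,1)} such that N' = N + Δ is a potential table (all entries nonnegative) that is also compatible with the observed table. -/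
open Finset

/-- Two predicates that agree away from `j` have the same count up to their values at `j`. -/
theorem card_filter_add_ite_eq_of_agree {α : Type*} [Fintype α] [DecidableEq α]
    (p q : α → Prop) [DecidablePred p] [DecidablePred q] (j : α)
    (h : ∀ i, i ≠ j → (p i ↔ q i)) :
    (univ.filter p).card + (if q j then 1 else 0) =
      (univ.filter q).card + (if p j then 1 else 0) := by
  rw [card_filter, card_filter, ← add_sum_erase _ _ (mem_univ j),
    ← add_sum_erase (a := j) univ (fun i => if q i then 1 else 0) (mem_univ j)]
  have hsum : ∑ i ∈ univ.erase j, (if p i then 1 else 0) =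
      ∑ i ∈ univ.erase j, (if q i then 1 else 0) :=
    sum_congr rfl fun i hi => if_congr (h i (ne_of_mem_erase hi)) rfl rfl
  rw [hsum]
  omega

/-- If every treated unit has `y0 = 0` and every control unit has `y1 = 1`, then
`N10 - N01 = n11 + n00`. -/
theorem potTable_sub_eq_of_extremal {n : ℕ} (y1 y0 : Fin n → Bool) (S : Finset (Fin n))
    (hS : ∀ j ∈ S, y0 j = false) (hSc : ∀ j ∉ S, y1 j = true) :
    ((potTable y1 y0).2.1 : ℤ) - (potTable y1 y0).2.2.1 = (nObs11 y1 S : ℤ) + nObs00 y0 S := by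
  have h01 : (potTable y1 y0).2.2.1 = 0 := by
    simp only [potTable, card_eq_zero, filter_eq_empty_iff]
    rintro j - ⟨h1, h0⟩
    by_cases hj : j ∈ S
    · simp [hS j hj] at h0
    · simp [hSc j hj] at h1
  have h10 : (potTable y1 y0).2.1 = nObs11 y1 S + nObs00 y0 S := by
    simp only [potTable, nObs11, nObs00]
    rw [← card_union_of_disjoint]
    · congr 1
      ext j
      by_cases hj : j ∈ S
      · simp [hj, hS j hj]
      · simp [hj, hSc j hj]
    · exact disjoint_filter_filter disjoint_compl_right
  rw [h01, h10]
  simp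

/-- Changing the control outcome of a treated unit does not change the observed table. -/
theorem obsTable_update_control {n : ℕ} (y1 y0 : Fin n → Bool) (S : Finset (Fin n))
    {j : Fin n} (hj : j ∈ S) (b : Bool) :
    obsTable y1 (Function.update y0 j b) S = obsTable y1 y0 S := by
  have h : ∀ i ∈ Sᶜ, Function.update y0 j b i = y0 i := fun i hi =>
    Function.update_of_ne (by rintro rfl; exact mem_compl.1 hi hj) _ _
  have hfilter (c : Bool) : Sᶜ.filter (fun i => Function.update y0 j b i = c) =
      Sᶜ.filter (fun i => y0 i = c) := filter_congr fun i hi => by rw [h i hi]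
  simp only [obsTable, nObs01, nObs00, hfilter]

/-- Changing the treatment outcome of a control unit does not change the observed table. -/
theorem obsTable_update_treated {n : ℕ} (y1 y0 : Fin n → Bool) (S : Finset (Fin n))
    {j : Fin n} (hj : j ∉ S) (b : Bool) :
    obsTable (Function.update y1 j b) y0 S = obsTable y1 y0 S := by
  have h : ∀ i ∈ S, Function.update y1 j b i = y1 i := fun i hi =>
    Function.update_of_ne (by rintro rfl; exact hj hi) _ _
  have hfilter (c : Bool) : S.filter (fun i => Function.update y1 j b i = c) =
      S.filter (fun i => y1 i = c) := filter_congr fun i hi => by rw [h i hi]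
  simp only [obsTable, nObs11, nObs10, hfilter]

/-- How the potential table changes when the outcomes of a single unit are modified. -/
theorem potTable_add_ite_eq_of_agree {n : ℕ} (y1 y0 z1 z0 : Fin n → Bool) (j : Fin n)
    (h1 : ∀ i, i ≠ j → z1 i = y1 i) (h0 : ∀ i, i ≠ j → z0 i = y0 i) :
    (potTable z1 z0).1 + (if y1 j = true ∧ y0 j = true then 1 else 0) =
        (potTable y1 y0).1 + (if z1 j = true ∧ z0 j = true then 1 else 0) ∧
      (potTable z1 z0).2.1 + (if y1 j = true ∧ y0 j = false then 1 else 0) =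
        (potTable y1 y0).2.1 + (if z1 j = true ∧ z0 j = false then 1 else 0) ∧
      (potTable z1 z0).2.2.1 + (if y1 j = false ∧ y0 j = true then 1 else 0) =
        (potTable y1 y0).2.2.1 + (if z1 j = false ∧ z0 j = true then 1 else 0) ∧
      (potTable z1 z0).2.2.2 + (if y1 j = false ∧ y0 j = false then 1 else 0) =
        (potTable y1 y0).2.2.2 + (if z1 j = false ∧ z0 j = false then 1 else 0) := by
  have hcount (a b : Bool) :
      (univ.filter fun i => z1 i = a ∧ z0 i = b).card + (if y1 j = a ∧ y0 j = b then 1 else 0) =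
        (univ.filter fun i => y1 i = a ∧ y0 i = b).card + (if z1 j = a ∧ z0 j = b then 1 else 0) :=
    card_filter_add_ite_eq_of_agree (fun i => z1 i = a ∧ z0 i = b)
      (fun i => y1 i = a ∧ y0 i = b) j fun i hi => by rw [h1 i hi, h0 i hi]
  exact ⟨hcount true true, hcount true false, hcount false true, hcount false false⟩

/-- Lemma A.9: if a potential table `N` is compatible with the
observed table and `N10 - N01 < n11 + n00`, then some `N' = N + Δ` with `Δ ∈ T` is a
potential table compatible with the observed table. -/
theorem exists_compatible_onemove (n m : ℕ) (hm : 0 < m) (hmn : m < n)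
    (n11 n10 n01 n00 : ℕ) (hobs1 : n11 + n10 = m) (hobs2 : n11 + n10 + n01 + n00 = n)
    (N11 N10 N01 N00 : ℕ)
    (hcomp : Compatible n m (N11, N10, N01, N00) (n11, n10, n01, n00))
    (hlt : (N10 : ℤ) - N01 < (n11 : ℤ) + n00) :
    ∃ Δ : ℤ × ℤ × ℤ × ℤ,
      (Δ = (0, 1, 0, -1) ∨ Δ = (-1, 1, 0, 0) ∨ Δ = (1, 0, -1, 0) ∨ Δ = (0, 0, -1, 1)) ∧
      ∃ N11' N10' N01' N00' : ℕ,
        (N11' : ℤ) = (N11 : ℤ) + Δ.1 ∧ (N10' : ℤ) = (N10 : ℤ) + Δ.2.1 ∧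
        (N01' : ℤ) = (N01 : ℤ) + Δ.2.2.1 ∧ (N00' : ℤ) = (N00 : ℤ) + Δ.2.2.2 ∧
        Compatible n m (N11', N10', N01', N00') (n11, n10, n01, n00) := by
  obtain ⟨y1, y0, S, hS, hN, hobs⟩ := hcomp
  have hflip : (∃ j ∈ S, y0 j = true) ∨ ∃ j ∉ S, y1 j = false := by
    by_contra! hcon
    have h := potTable_sub_eq_of_extremal y1 y0 S
      (fun j hj => by simpa using hcon.1 j hj) (fun j hj => by simpa using hcon.2 j hj)
    simp only [obsTable, Prod.mk.injEq] at hobs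
    rw [hN, hobs.1, hobs.2.2.2] at h
    exact hlt.ne h
  rcases hflip with ⟨j, hj, hy⟩ | ⟨j, hj, hy⟩
  · have hcount := potTable_add_ite_eq_of_agree y1 y0 y1 (Function.update y0 j false) j
      (fun _ _ => rfl) (fun i hi => Function.update_of_ne hi _ _)
    have hcompat : Compatible n m (potTable y1 (Function.update y0 j false))
        (n11, n10, n01, n00) :=
      ⟨y1, _, S, hS, rfl, (obsTable_update_control y1 y0 S hj false).trans hobs⟩
    rw [hN] at hcount
    generalize potTable y1 (Function.update y0 j false) = N' at hcount hcompat
    obtain ⟨N11', N10', N01', N00'⟩ := N'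
    cases hy1 : y1 j <;> simp [hy, hy1] at hcount
    · refine ⟨(0, 0, -1, 1), by simp, N11', N10', N01', N00', ?_, ?_, ?_, ?_, hcompat⟩ <;>
        dsimp only <;> omega
    · refine ⟨(-1, 1, 0, 0), by simp, N11', N10', N01', N00', ?_, ?_, ?_, ?_, hcompat⟩ <;>
        dsimp only <;> omega
  · have hcount := potTable_add_ite_eq_of_agree y1 y0 (Function.update y1 j true) y0 j
      (fun i hi => Function.update_of_ne hi _ _) (fun _ _ => rfl)
    have hcompat : Compatible n m (potTable (Function.update y1 j true) y0)
        (n11, n10, n01, n00) :=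
      ⟨_, y0, S, hS, rfl, (obsTable_update_treated y1 y0 S hj true).trans hobs⟩
    rw [hN] at hcount
    generalize potTable (Function.update y1 j true) y0 = N' at hcount hcompat
    obtain ⟨N11', N10', N01', N00'⟩ := N'
    cases hy0 : y0 j <;> simp [hy, hy0] at hcount
    · refine ⟨(0, 1, 0, -1), by simp, N11', N10', N01', N00', ?_, ?_, ?_, ?_, hcompat⟩ <;>
        dsimp only <;> omega
    · refine ⟨(1, 0, -1, 0), by simp, N11', N10', N01', N00', ?_, ?_, ?_, ?_, hcompat⟩ <;>
        dsimp only <;> omega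
end

section
/- Assume the experiment is balanced, n = 2m. Fix an observed table (n11, n10, n01, n00) with n11 + n10 = m and total sum n, a level α ∈ (0,1), and the rational threshold t = n11/m − n01/(n − m). Let A = {N10 − N01 : N = (N11, N10, N01, N00) is a potential table compatible with the observed table and p2(N) ≥ α} ⊆ ℤ. Then A is an interval of integers: if k1, k2 ∈ A and k1 ≤ k ≤ k2 for an integer k, then k ∈ A. -/
open Finset

/-- The unnormalized causal effect `∑ j, (y1 j - y0 j)`. -/
def effectSum {n : ℕ} (y1 y0 : Fin n → Bool) : ℤ := ∑ j, ((y1 j).toInt - (y0 j).toInt)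

/-- The scaled estimation error `n (τ̂(S) - τ)` of a balanced experiment. -/
def scaledError {n : ℕ} (y1 y0 : Fin n → Bool) (S : Finset (Fin n)) : ℤ :=
  ∑ j, if j ∈ S then (y1 j).toInt + (y0 j).toInt else -((y1 j).toInt + (y0 j).toInt)

lemma card_filter_eq_sum_toInt {n : ℕ} (y : Fin n → Bool) (S : Finset (Fin n)) :
    ((S.filter (fun j => y j = true)).card : ℤ) = ∑ j ∈ S, (y j).toInt := by
  rw [Finset.card_filter]
  push_cast
  refine Finset.sum_congr rfl fun j _ => ?_
  cases y j <;> simp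

lemma potTable_sub_eq_effectSum {n : ℕ} (y1 y0 : Fin n → Bool) :
    ((potTable y1 y0).2.1 : ℤ) - (potTable y1 y0).2.2.1 = effectSum y1 y0 := by
  simp only [potTable, effectSum, Finset.card_filter]
  push_cast
  rw [← Finset.sum_sub_distrib]
  refine Finset.sum_congr rfl fun j _ => ?_
  cases y1 j <;> cases y0 j <;> simp

lemma effectSum_eq_sum_add_sum_compl {n : ℕ} (y1 y0 : Fin n → Bool) (S : Finset (Fin n)) :
    effectSum y1 y0 = (∑ j ∈ S, (y1 j).toInt + ∑ j ∈ Sᶜ, (y1 j).toInt)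
      - (∑ j ∈ S, (y0 j).toInt + ∑ j ∈ Sᶜ, (y0 j).toInt) := by
  rw [Finset.sum_add_sum_compl, Finset.sum_add_sum_compl, effectSum, Finset.sum_sub_distrib]

lemma scaledError_eq {n : ℕ} (y1 y0 : Fin n → Bool) (S : Finset (Fin n)) :
    scaledError y1 y0 S = 2 * (nObs11 y1 S : ℤ) - 2 * nObs01 y0 S - effectSum y1 y0 := by
  rw [nObs11, nObs01, card_filter_eq_sum_toInt, card_filter_eq_sum_toInt,
    effectSum_eq_sum_add_sum_compl y1 y0 S, scaledError, ← Finset.sum_add_sum_compl S,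
    Finset.sum_congr rfl (fun j hj => if_pos hj),
    Finset.sum_congr rfl (fun j hj => if_neg (Finset.mem_compl.1 hj)),
    Finset.sum_neg_distrib, Finset.sum_add_distrib, Finset.sum_add_distrib]
  ring

lemma abs_scaledError_sub_le {n : ℕ} {y1 y0 z1 z0 : Fin n → Bool}
    (h1 : ∀ j, y1 j ≤ z1 j) (h0 : ∀ j, z0 j ≤ y0 j) (S : Finset (Fin n)) :
    |scaledError z1 z0 S - scaledError y1 y0 S| ≤ effectSum z1 z0 - effectSum y1 y0 := by
  rw [scaledError, scaledError, effectSum, effectSum, ← Finset.sum_sub_distrib,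
    ← Finset.sum_sub_distrib]
  refine (Finset.abs_sum_le_sum_abs _ _).trans (Finset.sum_le_sum fun j _ => ?_)
  have h1 := h1 j
  have h0 := h0 j
  revert h1 h0
  by_cases hj : j ∈ S <;> simp only [hj, if_true, if_false] <;>
    cases y1 j <;> cases y0 j <;> cases z1 j <;> cases z0 j <;> decide

lemma pTwo_le_pTwo_of_imp {n m : ℕ} (hm : 0 < m) (hbal : n = 2 * m) {t : ℚ} {T : ℤ}
    (ht : t = T / n) {y1 y0 z1 z0 : Fin n → Bool}
    (h : ∀ S, |T - effectSum y1 y0| ≤ |scaledError y1 y0 S| →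
      |T - effectSum z1 z0| ≤ |scaledError z1 z0 S|) :
    pTwo m t y1 y0 ≤ pTwo m t z1 z0 := by
  have hmQ : (0 : ℚ) < m := by exact_mod_cast hm
  have hnQ : (0 : ℚ) < n := by rw [hbal]; push_cast; linarith
  have key : ∀ (x1 x0 : Fin n → Bool) (S : Finset (Fin n)),
      |t - tauPO x1 x0| ≤ |tauHat m x1 x0 S - tauPO x1 x0| ↔
        |T - effectSum x1 x0| ≤ |scaledError x1 x0 S| := by
    intro x1 x0 S
    have hτ : tauPO x1 x0 = (effectSum x1 x0 : ℚ) / n := by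
      rw [tauPO, ← potTable_sub_eq_effectSum]; push_cast; rfl
    have e1 : t - tauPO x1 x0 = ((T - effectSum x1 x0 : ℤ) : ℚ) / n := by
      rw [ht, hτ]; push_cast; ring
    have e2 : tauHat m x1 x0 S - tauPO x1 x0 = (scaledError x1 x0 S : ℚ) / n := by
      have hnm : (n : ℚ) - m = m := by rw [hbal]; push_cast; ring
      have hn : (n : ℚ) = 2 * m := by rw [hbal]; push_cast; ring
      rw [hτ, tauHat, hnm, scaledError_eq, hn]
      push_cast
      field_simp
    rw [e1, e2, abs_div, abs_div, abs_of_pos hnQ, div_le_div_iff_of_pos_right hnQ]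
    exact_mod_cast Iff.rfl
  unfold pTwo
  gcongr ((?_ : ℕ) : ℚ) / _
  refine Finset.card_le_card (Finset.monotone_filter_right _ fun S _ hS => ?_)
  rw [key] at hS ⊢
  exact h S hS

lemma exists_equiv_of_potTable_eq {n : ℕ} {y1 y0 z1 z0 : Fin n → Bool}
    (h : potTable y1 y0 = potTable z1 z0) :
    ∃ e : Fin n ≃ Fin n, y1 = z1 ∘ e ∧ y0 = z0 ∘ e := by
  simp only [potTable, Prod.mk.injEq] at h
  have hf : ∀ c : Bool × Bool, Nonempty
      ({j // (y1 j, y0 j) = c} ≃ {j // (z1 j, z0 j) = c}) := by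
    rintro ⟨a, b⟩
    rw [← Fintype.card_eq, Fintype.card_subtype, Fintype.card_subtype]
    cases a <;> cases b <;> simp only [Prod.mk.injEq] <;> tauto
  let e := Equiv.ofFiberEquiv (f := fun j => (y1 j, y0 j)) (g := fun j => (z1 j, z0 j))
    fun c => (hf c).some
  have he : ∀ j, (z1 (e j), z0 (e j)) = (y1 j, y0 j) := fun j =>
    Equiv.ofFiberEquiv_map (f := fun j => (y1 j, y0 j)) (g := fun j => (z1 j, z0 j)) _ j
  exact ⟨e, funext fun j => (congrArg Prod.fst (he j)).symm,
    funext fun j => (congrArg Prod.snd (he j)).symm⟩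

lemma tauHat_comp_equiv {n : ℕ} (m : ℕ) (y1 y0 : Fin n → Bool) (e : Fin n ≃ Fin n)
    (S : Finset (Fin n)) :
    tauHat m (y1 ∘ e) (y0 ∘ e) S = tauHat m y1 y0 (S.map e.toEmbedding) := by
  have h1 : nObs11 y1 (S.map e.toEmbedding) = nObs11 (y1 ∘ e) S := by
    rw [nObs11, Finset.filter_map, Finset.card_map]; rfl
  have h0 : nObs01 y0 (S.map e.toEmbedding) = nObs01 (y0 ∘ e) S := by
    have hc : (S.map e.toEmbedding)ᶜ = Sᶜ.map e.toEmbedding := by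
      ext j; simp [Finset.mem_map_equiv]
    rw [nObs01, hc, Finset.filter_map, Finset.card_map]; rfl
  rw [tauHat, tauHat, h1, h0]

lemma pTwo_eq_of_potTable_eq {n : ℕ} (m : ℕ) (t : ℚ) {y1 y0 z1 z0 : Fin n → Bool}
    (h : potTable y1 y0 = potTable z1 z0) : pTwo m t y1 y0 = pTwo m t z1 z0 := by
  have hτ : tauPO y1 y0 = tauPO z1 z0 := by rw [tauPO, tauPO, h]
  obtain ⟨e, rfl, rfl⟩ := exists_equiv_of_potTable_eq h
  rw [pTwo, pTwo, hτ]
  congr 2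
  refine Finset.card_equiv e.finsetCongr fun S => ?_
  simp [tauHat_comp_equiv, Finset.mem_powersetCard]

lemma card_filter_val_eq {n a b : ℕ} (hb : b ≤ n) (p : Fin n → Prop) [DecidablePred p]
    (hp : ∀ j : Fin n, p j ↔ a ≤ j.val ∧ j.val < b) : (univ.filter p).card = b - a := by
  rw [← Nat.card_Ico, ← Finset.card_map Fin.valEmbedding]
  congr 1
  ext i
  simp only [Finset.mem_map, Finset.mem_filter, Finset.mem_univ, true_and, hp, Finset.mem_Ico,
    Fin.valEmbedding_apply]
  constructor
  · rintro ⟨j, hj, rfl⟩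
    exact hj
  · exact fun hi => ⟨⟨i, by omega⟩, hi, rfl⟩

lemma potTable_can {n N11 N10 N01 N00 : ℕ} (h : N11 + N10 + N01 + N00 = n) :
    potTable (canY1 n N11 N10) (canY0 n N11 N10 N01) = (N11, N10, N01, N00) := by
  simp only [potTable, canY1, canY0, decide_eq_true_eq, decide_eq_false_iff_not]
  rw [card_filter_val_eq (a := 0) (b := N11), card_filter_val_eq (a := N11) (b := N11 + N10),
    card_filter_val_eq (a := N11 + N10) (b := N11 + N10 + N01),
    card_filter_val_eq (a := N11 + N10 + N01) (b := n)]
  · simp only [Prod.mk.injEq]; omega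
  all_goals omega

lemma potTable_sum {n : ℕ} (y1 y0 : Fin n → Bool) :
    (potTable y1 y0).1 + (potTable y1 y0).2.1 + (potTable y1 y0).2.2.1
      + (potTable y1 y0).2.2.2 = n := by
  simp only [potTable, Finset.card_filter]
  rw [← Finset.sum_add_distrib, ← Finset.sum_add_distrib, ← Finset.sum_add_distrib]
  conv_rhs => rw [← Fintype.card_fin n, ← Finset.card_univ, Finset.card_eq_sum_ones]
  refine Finset.sum_congr rfl fun j _ => ?_
  cases y1 j <;> cases y0 j <;> simp

lemma pTwoTable_eq_pTwo {n : ℕ} (m : ℕ) (t : ℚ) {y1 y0 : Fin n → Bool} {N11 N10 N01 N00 : ℕ}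
    (h : potTable y1 y0 = (N11, N10, N01, N00)) :
    pTwoTable n m t N11 N10 N01 N00 = pTwo m t y1 y0 := by
  have hs := potTable_sum y1 y0
  rw [h] at hs
  have hc := potTable_can hs
  rw [pTwo_eq_of_potTable_eq m t (h.trans hc.symm), pTwo, pTwoTable, tauPO, hc]

/-- Raising unobserved treated outcomes and lowering unobserved control outcomes attains every
effect up to the largest one consistent with the observed data. -/
lemma exists_effectSum_eq {n : ℕ} (y1 y0 : Fin n → Bool) (S : Finset (Fin n)) {k : ℤ}
    (hk : effectSum y1 y0 ≤ k)
    (hk' : k ≤ ∑ j ∈ S, (y1 j).toInt + Sᶜ.card - ∑ j ∈ Sᶜ, (y0 j).toInt) :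
    ∃ z1 z0 : Fin n → Bool, (∀ j, y1 j ≤ z1 j) ∧ (∀ j, z0 j ≤ y0 j) ∧
      (∀ j ∈ S, z1 j = y1 j) ∧ (∀ j ∈ Sᶜ, z0 j = y0 j) ∧ effectSum z1 z0 = k := by
  have hcard : (((univ : Finset (Fin n)).filter
      (fun j => if j ∈ S then y0 j = true else y1 j = false)).card : ℤ)
      = ∑ j ∈ S, (y1 j).toInt + Sᶜ.card - ∑ j ∈ Sᶜ, (y0 j).toInt - effectSum y1 y0 := by
    rw [effectSum_eq_sum_add_sum_compl y1 y0 S, Finset.card_filter,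
      ← Finset.sum_add_sum_compl S, Finset.card_eq_sum_ones Sᶜ]
    push_cast
    have a1 : ∑ j ∈ S, (if (if j ∈ S then y0 j = true else y1 j = false) then (1 : ℤ) else 0)
        = ∑ j ∈ S, (y0 j).toInt :=
      Finset.sum_congr rfl fun j hj => by cases y0 j <;> simp [hj]
    have a2 : ∑ j ∈ Sᶜ, (if (if j ∈ S then y0 j = true else y1 j = false) then (1 : ℤ) else 0)
        = ∑ j ∈ Sᶜ, (1 - (y1 j).toInt) :=
      Finset.sum_congr rfl fun j hj => by
        cases y1 j <;> simp [Finset.mem_compl.1 hj]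
    rw [a1, a2, Finset.sum_sub_distrib]
    ring
  obtain ⟨G, hG, hGc⟩ := Finset.exists_subset_card_eq
    (show (k - effectSum y1 y0).toNat ≤ _ by
      zify; rw [hcard, Int.toNat_of_nonneg (by linarith)]; linarith)
  have hmem : ∀ j ∈ G, if j ∈ S then y0 j = true else y1 j = false := fun j hj =>
    (Finset.mem_filter.1 (hG hj)).2
  refine ⟨fun j => y1 j || decide (j ∈ G ∧ j ∉ S), fun j => y0 j && !decide (j ∈ G ∧ j ∈ S),
    fun j => Bool.left_le_or _ _, fun j => Bool.and_le_left _ _, fun j hj => by simp [hj],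
    fun j hj => by simp [Finset.mem_compl.1 hj], ?_⟩
  have hdiff : effectSum (fun j => y1 j || decide (j ∈ G ∧ j ∉ S))
      (fun j => y0 j && !decide (j ∈ G ∧ j ∈ S)) - effectSum y1 y0 = G.card := by
    rw [effectSum, effectSum, ← Finset.sum_sub_distrib, ← Finset.filter_univ_mem G,
      Finset.card_filter]
    push_cast
    refine Finset.sum_congr rfl fun j _ => ?_
    have hj := hmem j
    by_cases hjG : j ∈ G <;> by_cases hjS : j ∈ S <;> simp_all
  rw [hGc, Int.toNat_of_nonneg (by linarith)] at hdiff
  linarith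

lemma sum_toInt_nonneg {n : ℕ} (y : Fin n → Bool) (S : Finset (Fin n)) :
    0 ≤ ∑ j ∈ S, (y j).toInt := by
  rw [← card_filter_eq_sum_toInt]; positivity

lemma sum_toInt_le_card {n : ℕ} (y : Fin n → Bool) (S : Finset (Fin n)) :
    ∑ j ∈ S, (y j).toInt ≤ S.card := by
  rw [← card_filter_eq_sum_toInt]; exact_mod_cast Finset.card_filter_le _ _

lemma obsTable_congr {n : ℕ} {y1 y0 z1 z0 : Fin n → Bool} {S : Finset (Fin n)}
    (h1 : ∀ j ∈ S, z1 j = y1 j) (h0 : ∀ j ∈ Sᶜ, z0 j = y0 j) :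
    obsTable z1 z0 S = obsTable y1 y0 S := by
  simp only [obsTable, nObs11, nObs10, nObs01, nObs00]
  rw [Finset.filter_congr (fun j hj => by rw [h1 j hj] : ∀ j ∈ S, z1 j = true ↔ y1 j = true),
    Finset.filter_congr (fun j hj => by rw [h1 j hj] : ∀ j ∈ S, z1 j = false ↔ y1 j = false),
    Finset.filter_congr (fun j hj => by rw [h0 j hj] : ∀ j ∈ Sᶜ, z0 j = true ↔ y0 j = true),
    Finset.filter_congr (fun j hj => by rw [h0 j hj] : ∀ j ∈ Sᶜ, z0 j = false ↔ y0 j = false)]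

lemma effectSum_swap {n : ℕ} (y1 y0 : Fin n → Bool) : effectSum y0 y1 = -effectSum y1 y0 := by
  rw [effectSum, effectSum, ← Finset.sum_neg_distrib]
  exact Finset.sum_congr rfl fun j _ => by ring

/-- Theorem A.4: in balanced experiments, the set of values
`N10 - N01` over potential tables compatible with the observed table with
`p2(N) ≥ α` is an interval of integers. -/
theorem twoSided_confidence_set_is_interval (n m : ℕ) (hm : 0 < m) (hbal : n = 2 * m)
    (n11 n10 n01 n00 : ℕ) (hobs1 : n11 + n10 = m) (hobs2 : n11 + n10 + n01 + n00 = n)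
    (α : ℚ) (hα : 0 < α ∧ α < 1)
    (t : ℚ) (ht : t = (n11 : ℚ) / m - (n01 : ℚ) / ((n : ℚ) - m))
    (A : Set ℤ)
    (hA : A = {k : ℤ | ∃ N11 N10 N01 N00 : ℕ,
      Compatible n m (N11, N10, N01, N00) (n11, n10, n01, n00) ∧
      α ≤ pTwoTable n m t N11 N10 N01 N00 ∧ (N10 : ℤ) - N01 = k})
    (k1 k2 k : ℤ) (hk1 : k1 ∈ A) (hk2 : k2 ∈ A) (hle1 : k1 ≤ k) (hle2 : k ≤ k2) :
    k ∈ A := by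
  have hmQ : (0 : ℚ) < m := by exact_mod_cast hm
  have htT : t = ((2 * (n11 : ℤ) - 2 * n01 : ℤ) : ℚ) / n := by
    have hnm : (n : ℚ) - m = m := by rw [hbal]; push_cast; ring
    rw [ht, hnm, hbal]
    push_cast
    field_simp
  have hmem : ∀ l : ℤ, l ∈ A ↔ ∃ (y1 y0 : Fin n → Bool) (S : Finset (Fin n)), S.card = m ∧
      obsTable y1 y0 S = (n11, n10, n01, n00) ∧ α ≤ pTwo m t y1 y0 ∧ effectSum y1 y0 = l := by
    intro l
    rw [hA]
    constructor
    · rintro ⟨N11, N10, N01, N00, ⟨y1, y0, S, hS, hN, hobs⟩, hp, hl⟩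
      refine ⟨y1, y0, S, hS, hobs, pTwoTable_eq_pTwo m t hN ▸ hp, ?_⟩
      rw [← potTable_sub_eq_effectSum, hN]
      exact hl
    · rintro ⟨y1, y0, S, hS, hobs, hp, hl⟩
      refine ⟨_, _, _, _, ⟨y1, y0, S, hS, rfl, hobs⟩, ?_,
        (potTable_sub_eq_effectSum y1 y0).trans hl⟩
      rwa [pTwoTable_eq_pTwo m t (y1 := y1) (y0 := y0) rfl]
  rw [hmem] at hk1 hk2 ⊢
  obtain ⟨y1, y0, S, hS, hy, hpy, hky⟩ := hk1
  obtain ⟨z1, z0, R, hR, hz, hpz, hkz⟩ := hk2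
  have hSc : Sᶜ.card = m := by rw [Finset.card_compl, Fintype.card_fin, hS]; omega
  have hRc : Rᶜ.card = m := by rw [Finset.card_compl, Fintype.card_fin, hR]; omega
  have hcounts : ∀ {x1 x0 : Fin n → Bool} {Q : Finset (Fin n)},
      obsTable x1 x0 Q = (n11, n10, n01, n00) →
        ∑ j ∈ Q, (x1 j).toInt = n11 ∧ ∑ j ∈ Qᶜ, (x0 j).toInt = n01 := by
    intro x1 x0 Q h
    simp only [obsTable, Prod.mk.injEq] at h
    rw [← card_filter_eq_sum_toInt, ← card_filter_eq_sum_toInt]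
    exact ⟨congrArg _ h.1, congrArg _ h.2.2.1⟩
  obtain ⟨hy1, hy0⟩ := hcounts hy
  obtain ⟨hz1, hz0⟩ := hcounts hz
  rcases le_total k (2 * (n11 : ℤ) - 2 * n01) with hkT | hkT
  · have hbound := effectSum_eq_sum_add_sum_compl z1 z0 R
    have hle := sum_toInt_le_card z1 Rᶜ
    have hnn := sum_toInt_nonneg z0 R
    obtain ⟨x1, x0, h1, h0, hx1, hx0, hx⟩ := exists_effectSum_eq y1 y0 S (k := k)
      (by omega) (by omega)
    refine ⟨x1, x0, S, hS, (obsTable_congr hx1 hx0).trans hy,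
      hpy.trans (pTwo_le_pTwo_of_imp hm hbal htT fun Q hQ => ?_), hx⟩
    have hd := abs_scaledError_sub_le h1 h0 Q
    have htri := abs_sub_abs_le_abs_sub (scaledError y1 y0 Q) (scaledError x1 x0 Q)
    rw [abs_of_nonneg (by omega)] at hQ ⊢
    rw [abs_sub_comm] at htri
    linarith
  · have hbound := effectSum_eq_sum_add_sum_compl y1 y0 S
    have hle := sum_toInt_le_card y0 S
    have hnn := sum_toInt_nonneg y1 Sᶜ
    have hswap := effectSum_swap z1 z0
    obtain ⟨x0, x1, h0, h1, hx0, hx1, hx⟩ := exists_effectSum_eq z0 z1 Rᶜ (k := -k)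
      (by omega) (by rw [compl_compl]; omega)
    rw [compl_compl] at hx1
    rw [effectSum_swap, neg_inj] at hx
    refine ⟨x1, x0, R, hR, (obsTable_congr hx1 hx0).trans hz,
      hpz.trans (pTwo_le_pTwo_of_imp hm hbal htT fun Q hQ => ?_), hx⟩
    have hd := abs_scaledError_sub_le h1 h0 Q
    have htri := abs_sub_abs_le_abs_sub (scaledError z1 z0 Q) (scaledError x1 x0 Q)
    rw [abs_of_nonpos (by omega)] at hQ ⊢
    linarith
end
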